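/- Let z ~ N(0, Π) where Π ∈ R^{n×n} is a positive semidefinite matrix with strictly positive diagonal entries, and suppose the correlation matrix C = D^{-1/2} Π D^{-1/2} with D = Diag(Π) satisfies Σ_{i<j} C_{ij}² ≤ R for some constant R. Let p ≥ 6 be an integer. For each i ∈ [n], let φ_i: R → R be a function with mean μ_i = E_{x~N(0,Π_{ii})}[φ_i(x)] and finite (2p)-th centered moment E_{x~N(0,Π_{ii})}[(φ_i(x) − μ_i)^{2p}]. Define Q = (1/n) Σ_{i=1}^n φ_i(z_i). Then E[(Q − E[Q])^{2p}] ≤ 𝒞 · n^{-1.5} · max_{i∈[n]} E_{x~N(0,Π_{ii})}[(φ_i(x) − μ_i)^{2p}], where 𝒞 is a constant depending only on p and R (not on n or on the functions φ_i). -/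

import Mathlib

set_option autoImplicit false

open MeasureTheory ProbabilityTheory Matrix Filter

section

open scoped NNReal ENNReal

lemma integrable_gaussianReal_iff {μ : ℝ} {v : ℝ≥0} (hv : v ≠ 0) {f : ℝ → ℝ} :
    Integrable f (gaussianReal μ v) ↔ Integrable (fun y => gaussianPDFReal μ v y * f y) := by
  rw [gaussianReal_of_var_ne_zero μ hv, integrable_withDensity_iff_integrable_smul₀'
    (measurable_gaussianPDF μ v).aemeasurable (by simp [gaussianPDF_lt_top])]
  simp [toReal_gaussianPDF]

lemma sq_integral_mul_le {α : Type*} [MeasurableSpace α] {P : Measure α} {f g : α → ℝ}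
    (hf : Integrable (fun x => f x ^ 2) P) (hg : Integrable (fun x => g x ^ 2) P)
    (hfg : Integrable (fun x => f x * g x) P) :
    (∫ x, f x * g x ∂P) ^ 2 ≤ (∫ x, f x ^ 2 ∂P) * ∫ x, g x ^ 2 ∂P := by
  have h : ∀ t : ℝ, 0 ≤ (∫ x, f x ^ 2 ∂P) * (t * t) + (2 * ∫ x, f x * g x ∂P) * t
      + ∫ x, g x ^ 2 ∂P := fun t => by
    have h0 : 0 ≤ ∫ x, (t * f x + g x) ^ 2 ∂P := integral_nonneg fun x => sq_nonneg _
    have h1 : ∀ x, (t * f x + g x) ^ 2 = (t * t) * f x ^ 2 + (2 * t) * (f x * g x) + g x ^ 2 :=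
      fun x => by ring
    have h2 : Integrable (fun x => (t * t) * f x ^ 2 + (2 * t) * (f x * g x)) P :=
      (hf.const_mul _).add (hfg.const_mul _)
    simp_rw [h1] at h0
    rw [integral_add h2 hg,
      integral_add (hf.const_mul _) (hfg.const_mul _), integral_const_mul,
      integral_const_mul] at h0
    linarith
  have := discrim_le_zero h
  rw [discrim] at this
  linarith

/-- The density of `N(x, 1 - s)` with respect to `N(0, 1)`. -/
noncomputable def gaussianTilt (s x y : ℝ) : ℝ :=
  (√(1 - s))⁻¹ * Real.exp (y ^ 2 / 2 - (y - x) ^ 2 / (2 * (1 - s)))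

lemma gaussianTilt_mul_pdf {s : ℝ} (hs : s < 1) (x y : ℝ) :
    gaussianPDFReal 0 1 y * gaussianTilt s x y
      = gaussianPDFReal x (Real.toNNReal (1 - s)) y := by
  have h1 : 0 < 1 - s := by linarith
  rw [gaussianPDFReal_def, gaussianPDFReal_def, gaussianTilt, Real.coe_toNNReal _ h1.le]
  simp only [NNReal.coe_one, mul_one, sub_zero]
  rw [mul_mul_mul_comm, ← Real.exp_add]
  congr 2
  · rw [Real.sqrt_mul (by positivity) (1 - s), mul_inv]
  · ring

lemma gaussianTilt_sq_mul_pdf {s : ℝ} (hs0 : 0 ≤ s) (hs : s < 1) (x y : ℝ) :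
    gaussianPDFReal 0 1 y * gaussianTilt s x y ^ 2
      = ((√(1 - s ^ 2))⁻¹ * Real.exp (x ^ 2 / (1 + s))) *
        gaussianPDFReal (2 * x / (1 + s)) (Real.toNNReal ((1 - s) / (1 + s))) y := by
  have h1 : 0 < 1 - s := by linarith
  have h2 : 0 < 1 + s := by linarith
  rw [gaussianPDFReal_def, gaussianPDFReal_def, gaussianTilt, Real.coe_toNNReal _ (by positivity)]
  simp only [NNReal.coe_one, mul_one, sub_zero]
  have e1 : √(2 * Real.pi * ((1 - s) / (1 + s))) = √(2 * Real.pi) * (√(1 - s) / √(1 + s)) := by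
    rw [Real.sqrt_mul (by positivity), Real.sqrt_div h1.le]
  have e2 : √(1 - s ^ 2) = √(1 - s) * √(1 + s) := by
    rw [← Real.sqrt_mul h1.le]; congr 1; ring
  rw [e1, e2, mul_pow, ← Real.exp_nat_mul]
  have e3 : ∀ a b c d : ℝ, a * b * (c * d) = (a * c) * (b * d) := fun a b c d => by ring
  rw [e3, e3 (√(1 - s) * √(1 + s))⁻¹, ← Real.exp_add, ← Real.exp_add]
  have p1 := Real.sqrt_pos.2 h1
  have p2 := Real.sqrt_pos.2 h2
  have p3 : 0 < √(2 * Real.pi) := Real.sqrt_pos.2 (by positivity)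
  congr 1
  · field_simp
  · congr 1
    push_cast
    field_simp
    ring

lemma integrable_gaussianTilt_sq {s : ℝ} (hs0 : 0 ≤ s) (hs : s < 1) (x : ℝ) :
    Integrable (fun y => gaussianTilt s x y ^ 2) (gaussianReal 0 1) := by
  rw [integrable_gaussianReal_iff one_ne_zero]
  simp_rw [gaussianTilt_sq_mul_pdf hs0 hs]
  exact (integrable_gaussianPDFReal _ _).const_mul _

lemma integral_gaussianTilt_sq {s : ℝ} (hs0 : 0 ≤ s) (hs : s < 1) (x : ℝ) :
    ∫ y, gaussianTilt s x y ^ 2 ∂(gaussianReal 0 1)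
      = (√(1 - s ^ 2))⁻¹ * Real.exp (x ^ 2 / (1 + s)) := by
  rw [integral_gaussianReal_eq_integral_smul one_ne_zero]
  simp_rw [smul_eq_mul, gaussianTilt_sq_mul_pdf hs0 hs]
  rw [integral_const_mul, integral_gaussianPDFReal_eq_one, mul_one]
  have : 0 < (1 - s) / (1 + s) := div_pos (by linarith) (by linarith)
  simpa using this

lemma integral_mul_gaussianTilt {s : ℝ} (hs : s < 1) (x : ℝ) (f : ℝ → ℝ) :
    ∫ y, f y * gaussianTilt s x y ∂(gaussianReal 0 1)
      = ∫ y, f y ∂(gaussianReal x (Real.toNNReal (1 - s))) := by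
  rw [integral_gaussianReal_eq_integral_smul one_ne_zero,
    integral_gaussianReal_eq_integral_smul (by simpa using hs)]
  congr 1 with y
  rw [smul_eq_mul, smul_eq_mul, ← gaussianTilt_mul_pdf hs]
  ring

lemma measurable_gaussianTilt (s x : ℝ) : Measurable (gaussianTilt s x) := by
  unfold gaussianTilt; fun_prop

lemma inv_sqrt_mul_exp_sub_le {s : ℝ} (hs0 : 0 ≤ s) (hs : s ≤ 1 / 2) (x : ℝ) :
    (√(1 - s ^ 2))⁻¹ * Real.exp (x ^ 2 / (1 + s)) - 1 - x ^ 2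
      ≤ ((s + x ^ 2) * Real.exp (x ^ 2 / 2)) ^ 2 := by
  have h1 : (√(1 - s ^ 2))⁻¹ ≤ 1 + s ^ 2 := by
    have hpos : 0 < 1 - s ^ 2 := by nlinarith
    rw [inv_le_comm₀ (Real.sqrt_pos.2 hpos) (by positivity)]
    apply Real.le_sqrt_of_sq_le
    rw [inv_pow, inv_le_iff_one_le_mul₀ (by positivity)]
    have : s ^ 2 ≤ 1 / 4 := by nlinarith
    nlinarith [sq_nonneg s, mul_nonneg (sq_nonneg s) (sq_nonneg s)]
  have h2 : Real.exp (x ^ 2 / (1 + s)) ≤ Real.exp (x ^ 2) :=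
    Real.exp_le_exp.2 (div_le_self (sq_nonneg x) (by linarith))
  have h3 : Real.exp (x ^ 2) * (1 - x ^ 2) ≤ 1 := by
    have := Real.add_one_le_exp (-x ^ 2)
    calc Real.exp (x ^ 2) * (1 - x ^ 2) ≤ Real.exp (x ^ 2) * Real.exp (-x ^ 2) := by
          gcongr; linarith
      _ = 1 := by rw [← Real.exp_add]; simp
  have h4 : Real.exp (x ^ 2 / 2) ^ 2 = Real.exp (x ^ 2) := by
    rw [← Real.exp_nat_mul]; congr 1; push_cast; ring
  rw [mul_pow, h4]
  have h5 : (√(1 - s ^ 2))⁻¹ * Real.exp (x ^ 2 / (1 + s)) ≤ (1 + s ^ 2) * Real.exp (x ^ 2) := by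
    gcongr
  have h6 : 0 ≤ s * x ^ 2 * Real.exp (x ^ 2) := by positivity
  nlinarith [mul_le_mul_of_nonneg_left h3 (by positivity : 0 ≤ 1 + x ^ 2)]

lemma integrable_mul_of_sq {α : Type*} [MeasurableSpace α] {P : Measure α} {f g : α → ℝ}
    (hfm : AEStronglyMeasurable f P) (hgm : AEStronglyMeasurable g P)
    (hf : Integrable (fun x => f x ^ 2) P) (hg : Integrable (fun x => g x ^ 2) P) :
    Integrable (fun x => f x * g x) P :=
  ((memLp_two_iff_integrable_sq hfm).2 hf).integrable_mul ((memLp_two_iff_integrable_sq hgm).2 hg)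

lemma integrable_sq_gaussianReal (μ : ℝ) (v : ℝ≥0) :
    Integrable (fun y : ℝ => y ^ 2) (gaussianReal μ v) :=
  (memLp_two_iff_integrable_sq measurable_id.aestronglyMeasurable).1
    (memLp_id_gaussianReal' 2 (by simp))

lemma integral_sq_gaussianReal_zero_one : ∫ y, y ^ 2 ∂(gaussianReal 0 1) = 1 := by
  have := variance_fun_id_gaussianReal (μ := 0) (v := 1)
  rw [variance_eq_integral (by fun_prop)] at this
  simpa using this

/-- Second-order expansion of the Gaussian smoothing of a centered function. -/
lemma abs_integral_gaussianReal_sub_le {φ : ℝ → ℝ} (hφm : Measurable φ)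
    (hφ2 : Integrable (fun y => φ y ^ 2) (gaussianReal 0 1))
    (hφ0 : ∫ y, φ y ∂(gaussianReal 0 1) = 0) {s : ℝ} (hs0 : 0 ≤ s) (hs : s ≤ 1 / 2) (x : ℝ) :
    |∫ y, φ y ∂(gaussianReal x (Real.toNNReal (1 - s)))
        - (∫ y, φ y * y ∂(gaussianReal 0 1)) * x|
      ≤ √(∫ y, φ y ^ 2 ∂(gaussianReal 0 1)) * ((s + x ^ 2) * Real.exp (x ^ 2 / 2)) := by
  set γ := gaussianReal 0 1
  have hs1 : s < 1 := by linarith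
  set ρ := gaussianTilt s x
  have hρm : Measurable ρ := measurable_gaussianTilt s x
  have hρ2 : Integrable (fun y => ρ y ^ 2) γ := integrable_gaussianTilt_sq hs0 hs1 x
  have hy2 : Integrable (fun y : ℝ => y ^ 2) γ := integrable_sq_gaussianReal 0 1
  have h1 : Integrable (fun y : ℝ => y) γ :=
    (memLp_id_gaussianReal' 1 (by simp)).integrable le_rfl
  have hρ : Integrable ρ γ := ((memLp_two_iff_integrable_sq hρm.aestronglyMeasurable).2
    hρ2).integrable (by norm_num)
  have hφ : Integrable φ γ := ((memLp_two_iff_integrable_sq hφm.aestronglyMeasurable).2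
    hφ2).integrable (by norm_num)
  have hφρ : Integrable (fun y => φ y * ρ y) γ := integrable_mul_of_sq
    hφm.aestronglyMeasurable hρm.aestronglyMeasurable hφ2 hρ2
  have hφy : Integrable (fun y => φ y * y) γ := integrable_mul_of_sq
    hφm.aestronglyMeasurable measurable_id.aestronglyMeasurable hφ2 hy2
  have hyρ : Integrable (fun y => y * ρ y) γ := integrable_mul_of_sq
    measurable_id.aestronglyMeasurable hρm.aestronglyMeasurable hy2 hρ2
  have i1 : ∫ y, ρ y ∂γ = 1 := by
    have := integral_mul_gaussianTilt hs1 x (fun _ => 1)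
    simpa using this
  have i2 : ∫ y, y * ρ y ∂γ = x := by
    have := integral_mul_gaussianTilt hs1 x (fun y => y)
    simpa using this
  have i3 : ∫ y, y ^ 2 ∂γ = 1 := integral_sq_gaussianReal_zero_one
  have i4 : ∫ y, y ∂γ = 0 := integral_id_gaussianReal
  have hr2e : ∀ y, (ρ y - 1 - x * y) ^ 2 = (ρ y ^ 2 + (1 + x ^ 2 * y ^ 2))
      + (2 * x * y - (2 * ρ y + (2 * x) * (y * ρ y))) := fun y => by ring
  have hA : Integrable (fun y => 1 + x ^ 2 * y ^ 2) γ := (integrable_const _).add (hy2.const_mul _)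
  have hB : Integrable (fun y => 2 * ρ y + (2 * x) * (y * ρ y)) γ :=
    (hρ.const_mul _).add (hyρ.const_mul _)
  have hC : Integrable (fun y => 2 * x * y) γ := h1.const_mul _
  have hD : Integrable (fun y => ρ y ^ 2 + (1 + x ^ 2 * y ^ 2)) γ := hρ2.add hA
  have hE : Integrable (fun y => 2 * x * y - (2 * ρ y + (2 * x) * (y * ρ y))) γ := hC.sub hB
  have hr2 : Integrable (fun y => (ρ y - 1 - x * y) ^ 2) γ := by
    simp_rw [hr2e]
    exact hD.add hE
  have hr2i : ∫ y, (ρ y - 1 - x * y) ^ 2 ∂γ ≤ ((s + x ^ 2) * Real.exp (x ^ 2 / 2)) ^ 2 := by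
    simp_rw [hr2e]
    rw [integral_add hD hE, integral_add hρ2 hA, integral_sub hC hB,
      integral_add (integrable_const _) (hy2.const_mul _),
      integral_add (hρ.const_mul _) (hyρ.const_mul _)]
    have i5 : ∫ y, 2 * x * y ∂γ = 0 := by
      rw [integral_const_mul (2 * x) (fun y : ℝ => y), i4, mul_zero]
    simp only [integral_const_mul, i1, i2, i3, i5]
    rw [integral_gaussianTilt_sq hs0 hs1]
    have := inv_sqrt_mul_exp_sub_le hs0 hs x
    simp only [integral_const, probReal_univ, smul_eq_mul]
    linarith
  have hφr : Integrable (fun y => φ y * (ρ y - 1 - x * y)) γ := integrable_mul_of_sq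
    hφm.aestronglyMeasurable (by fun_prop) hφ2 hr2
  have key : ∫ y, φ y ∂(gaussianReal x (Real.toNNReal (1 - s))) - (∫ y, φ y * y ∂γ) * x
      = ∫ y, φ y * (ρ y - 1 - x * y) ∂γ := by
    have e : ∀ y, φ y * (ρ y - 1 - x * y) = φ y * ρ y - φ y - x * (φ y * y) := fun y => by ring
    simp_rw [e]
    have hF : Integrable (fun y => φ y * ρ y - φ y) γ := hφρ.sub hφ
    rw [integral_sub hF (hφy.const_mul _), integral_sub hφρ hφ, integral_const_mul,
      integral_mul_gaussianTilt hs1, hφ0]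
    ring
  rw [key]
  apply abs_le_of_sq_le_sq
  · rw [mul_pow, Real.sq_sqrt (integral_nonneg fun y => sq_nonneg _)]
    exact (sq_integral_mul_le hφ2 hr2 hφr).trans (by gcongr)
  · positivity

/-- An envelope for the remainder in the expansion of Gaussian smoothings. -/
noncomputable def gaussianEnvelope (N : ℕ) (x : ℝ) : ℝ := (1 + x ^ 2) * Real.exp (x ^ 2 / (16 * N))

lemma gaussianEnvelope_nonneg (N : ℕ) (x : ℝ) : 0 ≤ gaussianEnvelope N x := by
  unfold gaussianEnvelope; positivity

lemma one_add_sq_le_gaussianEnvelope (N : ℕ) (x : ℝ) : 1 + x ^ 2 ≤ gaussianEnvelope N x :=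
  le_mul_of_one_le_right (by positivity) (Real.one_le_exp (by positivity))

lemma measurable_gaussianEnvelope (N : ℕ) : Measurable (gaussianEnvelope N) := by
  unfold gaussianEnvelope; fun_prop

lemma nonneg_of_integral_gaussianEnvelope_pow_le {N : ℕ} {D : ℝ}
    (hD : ∫ x, gaussianEnvelope N x ^ N ∂(gaussianReal 0 1) ≤ D) : 0 ≤ D :=
  (integral_nonneg fun x => pow_nonneg (gaussianEnvelope_nonneg N x) N).trans hD

lemma integrable_gaussianEnvelope_pow {N : ℕ} (hN : 0 < N) :
    Integrable (fun x => gaussianEnvelope N x ^ N) (gaussianReal 0 1) := by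
  rw [integrable_gaussianReal_iff one_ne_zero]
  have hN' : (1 : ℝ) ≤ N := by exact_mod_cast hN
  refine Integrable.mono' ((integrable_exp_neg_mul_sq (b := 3 / 8) (by norm_num)).const_mul
    ((√(2 * Real.pi))⁻¹ * (16 * N : ℝ) ^ N)) (((measurable_gaussianPDFReal 0 1).mul
      ((measurable_gaussianEnvelope N).pow_const N)).aestronglyMeasurable)
      (ae_of_all _ fun x => ?_)
  rw [Real.norm_of_nonneg (mul_nonneg (gaussianPDFReal_nonneg _ _ _)
    (pow_nonneg (gaussianEnvelope_nonneg N x) N)), gaussianPDFReal_def]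
  simp only [NNReal.coe_one, mul_one, sub_zero]
  have h1 : 1 + x ^ 2 ≤ 16 * N * Real.exp (x ^ 2 / (16 * N)) := by
    have := Real.add_one_le_exp (x ^ 2 / (16 * N))
    calc 1 + x ^ 2 ≤ 16 * N * (x ^ 2 / (16 * N) + 1) := by
          field_simp; linarith
      _ ≤ _ := by gcongr
  have h2 : gaussianEnvelope N x ^ N ≤ (16 * N : ℝ) ^ N * Real.exp (x ^ 2 / 8) := by
    calc gaussianEnvelope N x ^ N
        ≤ (16 * N * Real.exp (x ^ 2 / (16 * N)) * Real.exp (x ^ 2 / (16 * N))) ^ N := by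
          refine pow_le_pow_left₀ (gaussianEnvelope_nonneg N x) ?_ N
          unfold gaussianEnvelope; gcongr
      _ = (16 * N : ℝ) ^ N * Real.exp (x ^ 2 / 8) := by
          rw [mul_assoc, mul_pow, ← Real.exp_add, ← Real.exp_nat_mul]
          congr 2
          field_simp; ring
  calc (√(2 * Real.pi))⁻¹ * Real.exp (-x ^ 2 / 2) * gaussianEnvelope N x ^ N
      ≤ (√(2 * Real.pi))⁻¹ * Real.exp (-x ^ 2 / 2) * ((16 * N : ℝ) ^ N * Real.exp (x ^ 2 / 8)) := by
        gcongr
    _ = (√(2 * Real.pi))⁻¹ * (16 * N : ℝ) ^ N * (Real.exp (-x ^ 2 / 2) * Real.exp (x ^ 2 / 8)) := by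
        ring
    _ = _ := by rw [← Real.exp_add]; congr 2; ring

lemma abs_prod_le_sum_pow {N : ℕ} (hN : Even N) (hN0 : 0 < N) (f : Fin N → ℝ) :
    |∏ k, f k| ≤ ∑ k, f k ^ N := by
  have : Nonempty (Fin N) := ⟨⟨0, hN0⟩⟩
  obtain ⟨k, -, hk⟩ := Finset.exists_max_image Finset.univ (fun k => |f k|) Finset.univ_nonempty
  rw [Finset.abs_prod]
  calc ∏ k, |f k| ≤ ∏ _i : Fin N, |f k| := Finset.prod_le_prod (fun _ _ => abs_nonneg _) hk
    _ = f k ^ N := by simp [hN.pow_abs]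
    _ ≤ _ := Finset.single_le_sum (f := fun k => f k ^ N) (fun i _ => hN.pow_nonneg (f i))
      (Finset.mem_univ k)

lemma integrable_prod_of_pow {α : Type*} [MeasurableSpace α] {P : Measure α} {N : ℕ} (hN : Even N)
    (hN0 : 0 < N) {f : Fin N → α → ℝ} (hf : ∀ k, Measurable (f k))
    (hi : ∀ k, Integrable (fun x => f k x ^ N) P) : Integrable (fun x => ∏ k, f k x) P :=
  Integrable.mono' (integrable_finsetSum Finset.univ fun k _ => hi k)
    (Finset.measurable_prod _ fun k _ => hf k).aestronglyMeasurable
    (ae_of_all _ fun x => abs_prod_le_sum_pow hN hN0 fun k => f k x)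

lemma integral_abs_prod_le {α : Type*} [MeasurableSpace α] {P : Measure α} {N : ℕ} (hN : Even N)
    (hN0 : 0 < N) {f : Fin N → α → ℝ} (hf : ∀ k, Measurable (f k))
    (hi : ∀ k, Integrable (fun x => f k x ^ N) P) {D : ℝ} (hD : ∀ k, ∫ x, f k x ^ N ∂P ≤ D) :
    ∫ x, |∏ k, f k x| ∂P ≤ N * D := by
  calc ∫ x, |∏ k, f k x| ∂P ≤ ∫ x, ∑ k, f k x ^ N ∂P :=
        integral_mono (integrable_prod_of_pow hN hN0 hf hi).abs
          (integrable_finsetSum Finset.univ fun k _ => hi k)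
          fun x => abs_prod_le_sum_pow hN hN0 fun k => f k x
    _ = ∑ k, ∫ x, f k x ^ N ∂P := integral_finsetSum _ fun k _ => hi k
    _ ≤ ∑ _k : Fin N, D := Finset.sum_le_sum fun k _ => hD k
    _ = N * D := by simp

section StdGaussian

variable {E : Type*} [NormedAddCommGroup E] [InnerProductSpace ℝ E] [FiniteDimensional ℝ E]
  [MeasurableSpace E] [BorelSpace E]

lemma stdGaussian_map_inner (w : E) :
    (stdGaussian E).map (fun g => inner ℝ w g) = gaussianReal 0 (Real.toNNReal (‖w‖ ^ 2)) := by
  have h : HasGaussianLaw (fun g => innerSL ℝ w g) (stdGaussian E) :=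
    (IsGaussian.hasGaussianLaw_id (μ := stdGaussian E)).map_fun (innerSL ℝ w)
  have h1 := h.map_eq_gaussianReal
  have h2 := variance_dual_stdGaussian (innerSL ℝ w)
  have h3 := integral_strongDual_stdGaussian (innerSL ℝ w)
  rw [h2, h3, innerSL_apply_norm] at h1
  exact h1

lemma indepFun_inner_starProjection (V : Submodule ℝ E) {w : E} (hw : w ∈ Vᗮ) :
    IndepFun (fun g => inner ℝ w g) (fun g => V.starProjection g) (stdGaussian E) := by
  have h : HasGaussianLaw (fun g => (innerSL ℝ w g, V.starProjection g)) (stdGaussian E) :=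
    (IsGaussian.hasGaussianLaw_id (μ := stdGaussian E)).map_fun
      ((innerSL ℝ w).prod V.starProjection)
  refine h.indepFun_of_covariance_inner fun x y => ?_
  have e1 : ∀ g : E, inner ℝ x (innerSL ℝ w g) = x * inner ℝ w g := fun g => by
    simp [mul_comm]
  have e2 : ∀ g : E, inner ℝ y (V.starProjection g) = inner ℝ (V.starProjection y) g := fun g =>
    (V.inner_starProjection_left_eq_right y g).symm
  simp_rw [e1, e2]
  rw [covariance_const_mul_left, ← covarianceBilin_apply_eq_cov IsGaussian.memLp_two_id,
    covarianceBilin_stdGaussian, innerSL_apply_apply,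
    Submodule.inner_left_of_mem_orthogonal (V.starProjection_apply_mem y) hw, mul_zero]

/-- Integrating out the part of a Gaussian variable independent of the other factor. -/
lemma integral_comp_inner_mul (V : Submodule ℝ E) (v : E) {φ : ℝ → ℝ} (hφ : Measurable φ)
    {H : E → ℝ} (hH : Measurable H) (hHV : ∀ g, H (V.starProjection g) = H g)
    (hint : Integrable (fun g => φ (inner ℝ v g) * H g) (stdGaussian E)) :
    Integrable (fun g => (∫ y, φ y ∂(gaussianReal (inner ℝ (V.starProjection v) g)
        (Real.toNNReal (‖v - V.starProjection v‖ ^ 2)))) * H g) (stdGaussian E) ∧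
    ∫ g, φ (inner ℝ v g) * H g ∂(stdGaussian E)
      = ∫ g, (∫ y, φ y ∂(gaussianReal (inner ℝ (V.starProjection v) g)
          (Real.toNNReal (‖v - V.starProjection v‖ ^ 2)))) * H g ∂(stdGaussian E) := by
  set w := v - V.starProjection v with hwdef
  have hw : w ∈ Vᗮ := V.sub_starProjection_mem_orthogonal v
  have hX : Measurable (fun g : E => inner ℝ w g) := by fun_prop
  have hY : Measurable (fun g : E => V.starProjection g) := by fun_prop
  have hind := (indepFun_iff_map_prod_eq_prod_map_map hX.aemeasurable hY.aemeasurable).1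
    (indepFun_inner_starProjection V hw)
  set Φ : ℝ × E → ℝ := fun q => φ (inner ℝ v q.2 + q.1) * H q.2 with hΦ
  have hΦm : Measurable Φ := by
    refine (hφ.comp ?_).mul (hH.comp measurable_snd)
    exact ((by fun_prop : Measurable fun g : E => inner ℝ v g).comp measurable_snd).add
      measurable_fst
  have e1 : ∀ g, φ (inner ℝ v g) * H g = Φ (inner ℝ w g, V.starProjection g) := fun g => by
    simp only [hΦ, hHV]
    rw [← V.inner_starProjection_left_eq_right, ← inner_add_left, hwdef, add_sub_cancel]
  have hint2 : Integrable Φ (((stdGaussian E).map fun g => inner ℝ w g).prod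
      ((stdGaussian E).map fun g => V.starProjection g)) := by
    rw [← hind, integrable_map_measure hΦm.aestronglyMeasurable (hX.prodMk hY).aemeasurable]
    exact hint.congr (ae_of_all _ e1)
  have := Measure.isProbabilityMeasure_map (μ := stdGaussian E) hX.aemeasurable
  have := Measure.isProbabilityMeasure_map (μ := stdGaussian E) hY.aemeasurable
  have e2 : ∀ g, ∫ x, Φ (x, V.starProjection g) ∂((stdGaussian E).map fun g => inner ℝ w g)
      = (∫ y, φ y ∂(gaussianReal (inner ℝ (V.starProjection v) g)
          (Real.toNNReal (‖w‖ ^ 2)))) * H g := fun g => by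
    simp only [hΦ, hHV]
    rw [integral_mul_const, stdGaussian_map_inner, ← V.inner_starProjection_left_eq_right,
      ← zero_add (inner ℝ (V.starProjection v) g), ← gaussianReal_map_const_add, integral_map
        (by fun_prop) hφ.aestronglyMeasurable]
    simp
  have hint3 := hint2.integral_prod_right
  simp_rw [← e2]
  refine ⟨(integrable_map_measure hint3.aestronglyMeasurable hY.aemeasurable).1 hint3, ?_⟩
  simp_rw [e1]
  rw [← integral_map (φ := fun g => (inner ℝ w g, V.starProjection g)) (hX.prodMk hY).aemeasurable
    hΦm.aestronglyMeasurable, hind, integral_prod_symm _ hint2,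
    integral_map hY.aemeasurable hint3.aestronglyMeasurable]

end StdGaussian

section
variable {E : Type*} [NormedAddCommGroup E] [InnerProductSpace ℝ E]

lemma sum_sq_le_two_mul_norm_sq {ι : Type*} (T : Finset ι) {b : ι → E}
    (hb : ∀ i, ‖b i‖ = 1) {δ : ℝ} (hδ0 : 0 ≤ δ)
    (hδ : ∀ i ∈ T, ∀ j ∈ T, i ≠ j → |inner ℝ (b i) (b j)| ≤ δ)
    (hT : T.card * δ ≤ 1 / 2) (a : ι → ℝ) :
    ∑ j ∈ T, a j ^ 2 ≤ 2 * ‖∑ j ∈ T, a j • b j‖ ^ 2 := by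
  classical
  have h1 : ‖∑ j ∈ T, a j • b j‖ ^ 2 = ∑ i ∈ T, ∑ j ∈ T, a i * a j * inner ℝ (b i) (b j) := by
    rw [← real_inner_self_eq_norm_sq, sum_inner]
    refine Finset.sum_congr rfl fun i _ => ?_
    rw [inner_sum]
    refine Finset.sum_congr rfl fun j _ => ?_
    rw [real_inner_smul_left, real_inner_smul_right]
    ring
  have h2 : ∑ i ∈ T, ∑ j ∈ T, ((if i = j then a i ^ 2 else 0) - δ * (a i ^ 2 + a j ^ 2) / 2)
      ≤ ‖∑ j ∈ T, a j • b j‖ ^ 2 := by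
    rw [h1]
    refine Finset.sum_le_sum fun i hi => Finset.sum_le_sum fun j hj => ?_
    split_ifs with h
    · subst h
      rw [real_inner_self_eq_norm_sq, hb]
      nlinarith [mul_nonneg hδ0 (sq_nonneg (a i))]
    · have h3 := hδ i hi j hj h
      have h4 : |a i * a j * inner ℝ (b i) (b j)| ≤ (a i ^ 2 + a j ^ 2) / 2 * δ := by
        rw [abs_mul]
        refine mul_le_mul ?_ h3 (abs_nonneg _) (by positivity)
        rw [abs_le]
        constructor <;> nlinarith [sq_nonneg (a i + a j), sq_nonneg (a i - a j)]
      have := (abs_le.1 h4).1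
      linarith
  have h5 : ∑ i ∈ T, ∑ j ∈ T, ((if i = j then a i ^ 2 else 0) - δ * (a i ^ 2 + a j ^ 2) / 2)
      = ∑ j ∈ T, a j ^ 2 - T.card * δ * ∑ j ∈ T, a j ^ 2 := by
    have e : ∀ i ∈ T, ∑ j ∈ T, ((if i = j then a i ^ 2 else 0) - δ * (a i ^ 2 + a j ^ 2) / 2)
        = a i ^ 2 - (T.card * δ / 2 * a i ^ 2 + δ / 2 * ∑ j ∈ T, a j ^ 2) := fun i hi => by
      rw [Finset.sum_sub_distrib, Finset.sum_ite_eq, if_pos hi, ← Finset.sum_div, ← Finset.mul_sum,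
        Finset.sum_add_distrib, Finset.sum_const, nsmul_eq_mul]
      ring
    rw [Finset.sum_congr rfl e, Finset.sum_sub_distrib, Finset.sum_add_distrib, ← Finset.mul_sum,
      Finset.sum_const, nsmul_eq_mul]
    ring
  have h6 : 0 ≤ ∑ j ∈ T, a j ^ 2 := Finset.sum_nonneg fun j _ => sq_nonneg _
  nlinarith

lemma exists_starProjection_eq_sum [FiniteDimensional ℝ E] {ι : Type*} (T : Finset ι) {b : ι → E}
    (hb : ∀ i, ‖b i‖ = 1) {N S : ℝ} (hN : 1 ≤ N) (hTN : T.card ≤ N) (hS : S ≤ (1 / (4 * N)) ^ 2)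
    (hbS : ∀ i ∈ T, ∀ j ∈ T, i ≠ j → inner ℝ (b i) (b j) ^ 2 ≤ S) (v : E)
    (hv : ∀ j ∈ T, inner ℝ v (b j) ^ 2 ≤ S) (hS0 : 0 ≤ S) :
    ∃ a : ι → ℝ, (Submodule.span ℝ (Set.image b T)).starProjection v = ∑ j ∈ T, a j • b j ∧
      ∑ j ∈ T, a j ^ 2 ≤ 4 * N * S ∧
      ‖(Submodule.span ℝ (Set.image b T)).starProjection v‖ ^ 2 ≤ 2 * N * S := by
  set V := Submodule.span ℝ (Set.image b T)
  set u := V.starProjection v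
  have hu : u ∈ V := V.starProjection_apply_mem v
  obtain ⟨a, ha⟩ : ∃ a : ι → ℝ, ∑ j ∈ T, a j • b j = u := by
    classical
    obtain ⟨c, hc⟩ := (Submodule.mem_span_image_finset_iff_exists_fun ℝ).1 hu
    refine ⟨fun i => if h : i ∈ T then c ⟨i, h⟩ else 0, ?_⟩
    rw [← hc, ← Finset.sum_coe_sort]
    simp
  have h1 := sum_sq_le_two_mul_norm_sq T hb (δ := 1 / (4 * N)) (by positivity)
    (fun i hi j hj hij => abs_le_of_sq_le_sq ((hbS i hi j hj hij).trans hS) (by positivity))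
    (by
      have : T.card * (1 / (4 * N)) ≤ N * (1 / (4 * N)) := by gcongr
      refine this.trans ?_
      have : N ≠ 0 := by linarith
      field_simp; norm_num) a
  rw [ha] at h1
  have h2 : ‖u‖ ^ 2 = ∑ j ∈ T, a j * inner ℝ v (b j) := by
    rw [← real_inner_self_eq_norm_sq]
    have : inner ℝ u u = inner ℝ v u := by
      change inner ℝ (V.starProjection v) u = _
      rw [V.inner_starProjection_left_eq_right, V.starProjection_eq_self_iff.2 hu]
    rw [this]
    conv_lhs => rw [← ha]
    rw [inner_sum]
    simp_rw [real_inner_smul_right]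
  have h3 : (‖u‖ ^ 2) ^ 2 ≤ (∑ j ∈ T, a j ^ 2) * (N * S) := by
    rw [h2]
    refine (Finset.sum_mul_sq_le_sq_mul_sq T a fun j => inner ℝ v (b j)).trans ?_
    gcongr
    calc ∑ j ∈ T, inner ℝ v (b j) ^ 2 ≤ ∑ _j ∈ T, S := Finset.sum_le_sum hv
      _ = T.card * S := by simp
      _ ≤ N * S := by gcongr
  have h4 : ‖u‖ ^ 2 ≤ 2 * N * S := by
    rcases eq_or_lt_of_le (sq_nonneg ‖u‖) with h | h
    · rw [← h]; positivity
    · have h5 : (‖u‖ ^ 2) * ‖u‖ ^ 2 ≤ (‖u‖ ^ 2) * (2 * N * S) := by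
        nlinarith [mul_nonneg (zero_le_one.trans hN) hS0]
      exact le_of_mul_le_mul_left h5 h
  exact ⟨a, ha.symm, by linarith, h4⟩

variable [FiniteDimensional ℝ E] [MeasurableSpace E] [BorelSpace E]

lemma stdGaussian_map_inner_of_norm_eq_one {e : E} (he : ‖e‖ = 1) :
    (stdGaussian E).map (fun g => inner ℝ e g) = gaussianReal 0 1 := by
  rw [stdGaussian_map_inner, he]; simp

lemma integrable_comp_inner {e : E} (he : ‖e‖ = 1) {f : ℝ → ℝ}
    (hi : Integrable f (gaussianReal 0 1)) :
    Integrable (fun g => f (inner ℝ e g)) (stdGaussian E) := by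
  rw [← stdGaussian_map_inner_of_norm_eq_one he] at hi
  exact (integrable_map_measure hi.aestronglyMeasurable (by fun_prop)).1 hi

lemma integral_comp_inner {e : E} (he : ‖e‖ = 1) {f : ℝ → ℝ}
    (hf : Measurable f) :
    ∫ g, f (inner ℝ e g) ∂(stdGaussian E) = ∫ x, f x ∂(gaussianReal 0 1) := by
  rw [← stdGaussian_map_inner_of_norm_eq_one he, integral_map (by fun_prop)
    hf.aestronglyMeasurable]

lemma integrable_prod_comp_inner {N : ℕ} (hN : Even N) (hN0 : 0 < N) {F : Fin N → ℝ → ℝ}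
    (hF : ∀ k, Measurable (F k))
    (hFi : ∀ k, Integrable (fun x => F k x ^ N) (gaussianReal 0 1))
    {c : Fin N → E} (hc : ∀ k, ‖c k‖ = 1) :
    Integrable (fun g => ∏ k, F k (inner ℝ (c k) g)) (stdGaussian E) :=
  integrable_prod_of_pow hN hN0 (fun k => (hF k).comp (by fun_prop))
    fun k => integrable_comp_inner (hc k) (hFi k)

lemma integral_abs_prod_comp_inner_le {N : ℕ} (hN : Even N) (hN0 : 0 < N) {F : Fin N → ℝ → ℝ}
    (hF : ∀ k, Measurable (F k))
    (hFi : ∀ k, Integrable (fun x => F k x ^ N) (gaussianReal 0 1))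
    {c : Fin N → E} (hc : ∀ k, ‖c k‖ = 1) {D : ℝ}
    (hD : ∀ k, ∫ x, F k x ^ N ∂(gaussianReal 0 1) ≤ D) :
    ∫ g, |∏ k, F k (inner ℝ (c k) g)| ∂(stdGaussian E) ≤ N * D :=
  integral_abs_prod_le hN hN0 (fun k => (hF k).comp (by fun_prop))
    (fun k => integrable_comp_inner (hc k) (hFi k)) fun k =>
      (integral_comp_inner (hc k) ((hF k).pow_const N)).trans_le (hD k)

end

section

lemma sq_le_one_add_pow {N : ℕ} (hN : Even N) (hN0 : 0 < N) (x : ℝ) : x ^ 2 ≤ 1 + x ^ N := by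
  have h2 : 2 ≤ N := by obtain ⟨r, rfl⟩ := hN; omega
  rw [← sq_abs, ← hN.pow_abs]
  rcases le_total |x| 1 with h | h
  · have := pow_le_one₀ (n := 2) (abs_nonneg x) h
    have := pow_nonneg (abs_nonneg x) N
    linarith
  · have := pow_le_pow_right₀ h h2
    linarith

lemma integrable_sq_of_integrable_pow {α : Type*} [MeasurableSpace α] {P : Measure α}
    [IsFiniteMeasure P] {N : ℕ} (hN : Even N) (hN0 : 0 < N) {f : α → ℝ} (hf : Measurable f)
    (hi : Integrable (fun x => f x ^ N) P) : Integrable (fun x => f x ^ 2) P :=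
  ((integrable_const 1).add hi).mono' (hf.pow_const 2).aestronglyMeasurable
    (ae_of_all _ fun x => by
      rw [Real.norm_of_nonneg (sq_nonneg _)]
      exact sq_le_one_add_pow hN hN0 (f x))

lemma integral_sq_le_one_add {α : Type*} [MeasurableSpace α] {P : Measure α}
    [IsProbabilityMeasure P] {N : ℕ} (hN : Even N) (hN0 : 0 < N) {f : α → ℝ} (hf : Measurable f)
    (hi : Integrable (fun x => f x ^ N) P) : ∫ x, f x ^ 2 ∂P ≤ 1 + ∫ x, f x ^ N ∂P := by
  have h : ∫ x, (1 + f x ^ N) ∂P = 1 + ∫ x, f x ^ N ∂P := by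
    rw [integral_add (integrable_const 1) hi]; simp
  rw [← h]
  exact integral_mono (integrable_sq_of_integrable_pow hN hN0 hf hi)
    ((integrable_const 1).add hi) fun x => sq_le_one_add_pow hN hN0 (f x)

lemma abs_pow_le_gaussianEnvelope_pow (N : ℕ) (x : ℝ) : |x| ^ N ≤ gaussianEnvelope N x ^ N := by
  refine pow_le_pow_left₀ (abs_nonneg x) (le_trans ?_ (one_add_sq_le_gaussianEnvelope N x)) N
  rw [← sq_abs]
  nlinarith [sq_nonneg (|x| - 1), abs_nonneg x]

lemma integrable_pow_gaussianReal {N : ℕ} (hN0 : 0 < N) :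
    Integrable (fun x : ℝ => x ^ N) (gaussianReal 0 1) :=
  (integrable_gaussianEnvelope_pow hN0).mono' (by fun_prop) (ae_of_all _ fun x => by
    rw [norm_pow, Real.norm_eq_abs]; exact abs_pow_le_gaussianEnvelope_pow N x)

lemma integral_pow_gaussianReal_le {N : ℕ} (hN : Even N) (hN0 : 0 < N) :
    ∫ x, x ^ N ∂(gaussianReal 0 1) ≤ ∫ x, gaussianEnvelope N x ^ N ∂(gaussianReal 0 1) :=
  integral_mono (integrable_pow_gaussianReal hN0) (integrable_gaussianEnvelope_pow hN0)
    fun x => by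
      have := abs_pow_le_gaussianEnvelope_pow N x
      rwa [hN.pow_abs] at this

variable {E : Type*} [NormedAddCommGroup E] [InnerProductSpace ℝ E]

lemma exists_eq_norm_smul (u : E) {v : E} (hv : ‖v‖ = 1) : ∃ e : E, ‖e‖ = 1 ∧ u = ‖u‖ • e := by
  rcases eq_or_ne u 0 with rfl | h
  · exact ⟨v, hv, by simp⟩
  · exact ⟨‖u‖⁻¹ • u, norm_smul_inv_norm h, by
      rw [smul_smul, mul_inv_cancel₀ (norm_ne_zero_iff.2 h), one_smul]⟩

lemma prod_update_comp_inner {N : ℕ} (F : Fin N → ℝ → ℝ) (c : Fin N → E) (k₀ : Fin N)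
    (f : ℝ → ℝ) (e g : E) :
    ∏ k, Function.update F k₀ f k (inner ℝ (Function.update c k₀ e k) g)
      = f (inner ℝ e g) * ∏ k ∈ Finset.univ.erase k₀, F k (inner ℝ (c k) g) := by
  rw [← Finset.mul_prod_erase _ _ (Finset.mem_univ k₀)]
  simp only [Function.update_self]
  congr 1
  refine Finset.prod_congr rfl fun k hk => ?_
  rw [Function.update_of_ne (Finset.ne_of_mem_erase hk),
    Function.update_of_ne (Finset.ne_of_mem_erase hk)]

variable [FiniteDimensional ℝ E] [MeasurableSpace E] [BorelSpace E]

/-- Normalised factors with `N`-th moment at most `D` under the standard Gaussian. -/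
structure IsGaussianFactor (N : ℕ) (D : ℝ) (f : ℝ → ℝ) : Prop where
  measurable : Measurable f
  integrable_pow : Integrable (fun x => f x ^ N) (gaussianReal 0 1)
  integral_pow_le : ∫ x, f x ^ N ∂(gaussianReal 0 1) ≤ D

lemma isGaussianFactor_envelope {N : ℕ} (hN0 : 0 < N) {D : ℝ}
    (hD : ∫ x, gaussianEnvelope N x ^ N ∂(gaussianReal 0 1) ≤ D) :
    IsGaussianFactor N D (gaussianEnvelope N) :=
  ⟨measurable_gaussianEnvelope N, integrable_gaussianEnvelope_pow hN0, hD⟩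

lemma isGaussianFactor_id {N : ℕ} (hN : Even N) (hN0 : 0 < N) {D : ℝ}
    (hD : ∫ x, gaussianEnvelope N x ^ N ∂(gaussianReal 0 1) ≤ D) :
    IsGaussianFactor N D id :=
  ⟨measurable_id, integrable_pow_gaussianReal hN0,
    (integral_pow_gaussianReal_le hN hN0).trans hD⟩

lemma IsGaussianFactor.update {N : ℕ} {D : ℝ} {F : Fin N → ℝ → ℝ}
    (hF : ∀ k, IsGaussianFactor N D (F k)) {f : ℝ → ℝ} (hf : IsGaussianFactor N D f)
    (k₀ k : Fin N) :
    IsGaussianFactor N D (Function.update F k₀ f k) := by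
  rcases eq_or_ne k k₀ with rfl | h
  · rwa [Function.update_self]
  · rw [Function.update_of_ne h]; exact hF k

section
variable {N : ℕ} {D : ℝ} {F : Fin N → ℝ → ℝ} {c : Fin N → E}

lemma integrable_factor_mul_prod_erase (hN : Even N) (hN0 : 0 < N)
    (hF : ∀ k, IsGaussianFactor N D (F k)) (hc : ∀ k, ‖c k‖ = 1)
    {f : ℝ → ℝ} (hf : IsGaussianFactor N D f) {e : E} (he : ‖e‖ = 1) (k₀ : Fin N) :
    Integrable (fun g => f (inner ℝ e g) * ∏ k ∈ Finset.univ.erase k₀, F k (inner ℝ (c k) g))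
      (stdGaussian E) := by
  have hF' := IsGaussianFactor.update hF hf k₀
  simp_rw [← prod_update_comp_inner]
  refine integrable_prod_comp_inner hN hN0 (fun k => (hF' k).measurable)
    (fun k => (hF' k).integrable_pow) fun k => ?_
  rcases eq_or_ne k k₀ with rfl | h
  · rwa [Function.update_self]
  · rw [Function.update_of_ne h]; exact hc k

lemma integral_abs_factor_mul_prod_erase_le (hN : Even N) (hN0 : 0 < N)
    (hF : ∀ k, IsGaussianFactor N D (F k)) (hc : ∀ k, ‖c k‖ = 1)
    {f : ℝ → ℝ} (hf : IsGaussianFactor N D f) {e : E} (he : ‖e‖ = 1) (k₀ : Fin N) :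
    ∫ g, |f (inner ℝ e g) * ∏ k ∈ Finset.univ.erase k₀, F k (inner ℝ (c k) g)| ∂(stdGaussian E)
      ≤ N * D := by
  have hF' := IsGaussianFactor.update hF hf k₀
  simp_rw [← prod_update_comp_inner]
  refine integral_abs_prod_comp_inner_le hN hN0 (fun k => (hF' k).measurable)
    (fun k => (hF' k).integrable_pow) (fun k => ?_) fun k => (hF' k).integral_pow_le
  rcases eq_or_ne k k₀ with rfl | h
  · rwa [Function.update_self]
  · rw [Function.update_of_ne h]; exact hc k

lemma abs_integral_mul_id_le (hN : Even N) (hN0 : 0 < N) {f : ℝ → ℝ}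
    (hf : IsGaussianFactor N D f) :
    |∫ y, f y * y ∂(gaussianReal 0 1)| ≤ √(1 + D) := by
  refine Real.abs_le_sqrt ?_
  have h1 := integral_sq_le_one_add hN hN0 hf.measurable hf.integrable_pow
  have h2 := hf.integral_pow_le
  have h3 := sq_integral_mul_le (P := gaussianReal 0 1) (f := f) (g := fun y => y)
    (integrable_sq_of_integrable_pow hN hN0 hf.measurable hf.integrable_pow)
    (integrable_sq_gaussianReal 0 1) (integrable_mul_of_sq hf.measurable.aestronglyMeasurable
      aestronglyMeasurable_id (integrable_sq_of_integrable_pow hN hN0 hf.measurable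
      hf.integrable_pow) (integrable_sq_gaussianReal 0 1))
  rw [integral_sq_gaussianReal_zero_one, mul_one] at h3
  linarith

/-- Linearisation of a centered factor of a product in terms of its projection
onto the span of the other factors. -/
lemma abs_integral_prod_sub_le (hN : Even N) (hN0 : 0 < N)
    (hF : ∀ k, IsGaussianFactor N D (F k)) (hc : ∀ k, ‖c k‖ = 1) {k₀ : Fin N}
    (hD : ∫ x, gaussianEnvelope N x ^ N ∂(gaussianReal 0 1) ≤ D)
    (h0 : ∫ x, F k₀ x ∂(gaussianReal 0 1) = 0) (V : Submodule ℝ E)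
    (hV : ∀ k, k ≠ k₀ → c k ∈ V) (hu : ‖V.starProjection (c k₀)‖ ^ 2 ≤ 1 / (8 * N)) :
    |∫ g, ∏ k, F k (inner ℝ (c k) g) ∂(stdGaussian E)
      - (∫ y, F k₀ y * y ∂(gaussianReal 0 1)) * ∫ g, inner ℝ (V.starProjection (c k₀)) g *
        ∏ k ∈ Finset.univ.erase k₀, F k (inner ℝ (c k) g) ∂(stdGaussian E)|
      ≤ √(1 + D) * ‖V.starProjection (c k₀)‖ ^ 2 * (N * D) := by
  have hN1 : (1 : ℝ) ≤ N := by exact_mod_cast hN0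
  set u := V.starProjection (c k₀) with hudef
  set H : E → ℝ := fun g => ∏ k ∈ Finset.univ.erase k₀, F k (inner ℝ (c k) g) with hH
  set c₁ := ∫ y, F k₀ y * y ∂(gaussianReal 0 1)
  obtain ⟨e, he, hue⟩ := exists_eq_norm_smul u (hc k₀)
  have hinner : ∀ g, inner ℝ u g = ‖u‖ * inner ℝ e g := fun g => by
    conv_lhs => rw [hue, real_inner_smul_left]
  have hHm : Measurable H := Finset.measurable_prod _ fun k _ =>
    (hF k).measurable.comp (by fun_prop)
  have hHV : ∀ g, H (V.starProjection g) = H g := fun g => by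
    refine Finset.prod_congr rfl fun k hk => ?_
    rw [← V.inner_starProjection_left_eq_right,
      V.starProjection_eq_self_iff.2 (hV k (Finset.ne_of_mem_erase hk))]
  have hprod : ∀ g, ∏ k, F k (inner ℝ (c k) g) = F k₀ (inner ℝ (c k₀) g) * H g := fun g =>
    (Finset.mul_prod_erase _ (fun k => F k (inner ℝ (c k) g)) (Finset.mem_univ k₀)).symm
  have hint := integrable_factor_mul_prod_erase hN hN0 hF hc (hF k₀) (hc k₀) k₀
  obtain ⟨hi, heq⟩ := integral_comp_inner_mul V (c k₀) (hF k₀).measurable hHm hHV hint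
  have hs : ‖c k₀ - u‖ ^ 2 = 1 - ‖u‖ ^ 2 := by
    have h1 := V.norm_sq_eq_add_norm_sq_starProjection (c k₀)
    rw [V.starProjection_orthogonal_val, hc k₀] at h1
    linarith
  simp only [hprod]
  rw [heq, ← integral_const_mul]
  have hid : Integrable (fun g => inner ℝ u g * H g) (stdGaussian E) := by
    have := (integrable_factor_mul_prod_erase hN hN0 hF hc
      (isGaussianFactor_id hN hN0 hD) he k₀).const_mul ‖u‖
    refine this.congr (ae_of_all _ fun g => ?_)
    simp only [id, hinner, hH]; ring
  have hG := integrable_factor_mul_prod_erase hN hN0 hF hc (isGaussianFactor_envelope hN0 hD) he k₀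
  rw [← integral_sub hi (hid.const_mul c₁)]
  refine abs_integral_le_integral_abs.trans ?_
  have hb : ∀ g, |(∫ y, F k₀ y ∂(gaussianReal (inner ℝ u g) (Real.toNNReal (‖c k₀ - u‖ ^ 2)))) * H g
      - c₁ * (inner ℝ u g * H g)| ≤ √(1 + D) * ‖u‖ ^ 2 *
        |gaussianEnvelope N (inner ℝ e g) * H g| := fun g => by
    rw [← mul_assoc, ← sub_mul, abs_mul, abs_mul, ← mul_assoc,
      abs_of_nonneg (gaussianEnvelope_nonneg N _)]
    refine mul_le_mul_of_nonneg_right ?_ (abs_nonneg _)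
    rw [hs]
    refine (abs_integral_gaussianReal_sub_le (hF k₀).measurable
      (integrable_sq_of_integrable_pow hN hN0 (hF k₀).measurable (hF k₀).integrable_pow)
      h0 (sq_nonneg ‖u‖) (hu.trans ?_) _).trans ?_
    · rw [div_le_div_iff₀ (by positivity) (by norm_num)]; linarith
    rw [mul_assoc]
    refine mul_le_mul (Real.sqrt_le_sqrt ?_) ?_ (by positivity) (by positivity)
    · have h1 := integral_sq_le_one_add hN hN0 (hF k₀).measurable (hF k₀).integrable_pow
      have h2 := (hF k₀).integral_pow_le
      linarith
    · have h3 : (‖u‖ * inner ℝ e g) ^ 2 / 2 ≤ inner ℝ e g ^ 2 / (16 * N) := by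
        rw [mul_pow]
        calc ‖u‖ ^ 2 * inner ℝ e g ^ 2 / 2 ≤ 1 / (8 * N) * inner ℝ e g ^ 2 / 2 := by gcongr
          _ = _ := by field_simp; ring
      rw [hinner, gaussianEnvelope, ← mul_assoc]
      refine mul_le_mul (le_of_eq (by ring)) (Real.exp_le_exp.2 h3) (by positivity) (by positivity)
  refine (integral_mono (hi.sub (hid.const_mul c₁)).abs (hG.abs.const_mul _) hb).trans ?_
  rw [integral_const_mul]
  gcongr
  exact integral_abs_factor_mul_prod_erase_le hN hN0 hF hc (isGaussianFactor_envelope hN0 hD) he k₀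

lemma abs_integral_prod_le_of_projection (hN : Even N) (hN0 : 0 < N)
    (hF : ∀ k, IsGaussianFactor N D (F k)) (hc : ∀ k, ‖c k‖ = 1) {k₀ : Fin N}
    (hD : ∫ x, gaussianEnvelope N x ^ N ∂(gaussianReal 0 1) ≤ D)
    (h0 : ∫ x, F k₀ x ∂(gaussianReal 0 1) = 0) (V : Submodule ℝ E)
    (hV : ∀ k, k ≠ k₀ → c k ∈ V) (hu : ‖V.starProjection (c k₀)‖ ^ 2 ≤ 1 / (8 * N)) :
    |∫ g, ∏ k, F k (inner ℝ (c k) g) ∂(stdGaussian E)|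
      ≤ 2 * √(1 + D) * (N * D) * ‖V.starProjection (c k₀)‖ := by
  have hN1 : (1 : ℝ) ≤ N := by exact_mod_cast hN0
  have h := abs_integral_prod_sub_le hN hN0 hF hc hD h0 V hV hu
  have hc₁ := abs_integral_mul_id_le hN hN0 (hF k₀)
  set u := V.starProjection (c k₀) with hudef
  obtain ⟨e, he, hue⟩ := exists_eq_norm_smul u (hc k₀)
  have hD0 : 0 ≤ D := nonneg_of_integral_gaussianEnvelope_pow_le hD
  have hu1 : ‖u‖ ≤ 1 := by
    have : 1 / (8 * (N : ℝ)) ≤ 1 := by rw [div_le_one (by positivity)]; linarith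
    exact (sq_le_one_iff₀ (norm_nonneg u)).1 (hu.trans this)
  have h2 : |∫ g, inner ℝ u g * ∏ k ∈ Finset.univ.erase k₀, F k (inner ℝ (c k) g) ∂(stdGaussian E)|
      ≤ ‖u‖ * (N * D) := by
    have hx : ∀ g, inner ℝ u g * ∏ k ∈ Finset.univ.erase k₀, F k (inner ℝ (c k) g) =
        ‖u‖ * (id (inner ℝ e g) * ∏ k ∈ Finset.univ.erase k₀, F k (inner ℝ (c k) g)) := fun g => by
      conv_lhs => rw [hue, real_inner_smul_left]
      simp only [id]; ring
    simp only [hx]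
    rw [integral_const_mul, abs_mul, abs_norm]
    gcongr
    exact abs_integral_le_integral_abs.trans
      (integral_abs_factor_mul_prod_erase_le hN hN0 hF hc (isGaussianFactor_id hN hN0 hD) he k₀)
  have h3 := abs_le.1 h
  have h4 := mul_le_mul hc₁ h2 (abs_nonneg _) (by positivity)
  rw [← abs_mul] at h4
  have h5 := abs_le.1 h4
  have h6 : √(1 + D) * ‖u‖ ^ 2 * (N * D) ≤ √(1 + D) * ‖u‖ * (N * D) := by
    gcongr
    nlinarith [norm_nonneg u]
  rw [abs_le]
  constructor <;> linarith [h3.1, h3.2, h5.1, h5.2]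

end
end

section
variable {E : Type*} [NormedAddCommGroup E] [InnerProductSpace ℝ E]
  [FiniteDimensional ℝ E] {ι : Type*} {N : ℕ} {D S : ℝ} {b : ι → E} {τ : Fin N → ι} {I : Set ι}
  {F : Fin N → ℝ → ℝ}

open Classical in
lemma exists_projection_erase (hN0 : 0 < N) (hb : ∀ i, ‖b i‖ = 1) (hS0 : 0 ≤ S)
    (hS : S ≤ (1 / (4 * N)) ^ 2) (hI : ∀ i ∈ I, ∀ j ∈ I, i ≠ j → inner ℝ (b i) (b j) ^ 2 ≤ S)
    (hτ : ∀ k, τ k ∈ I) {k₀ : Fin N} (hk₀ : ∀ k, k ≠ k₀ → τ k ≠ τ k₀) :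
    ∃ (T : Finset ι) (V : Submodule ℝ E) (a : ι → ℝ), T.card ≤ N ∧ (∀ j ∈ T, ∃ k, τ k = j) ∧
      (∀ k, k ≠ k₀ → b (τ k) ∈ V) ∧ V.starProjection (b (τ k₀)) = ∑ j ∈ T, a j • b j ∧
      ∑ j ∈ T, a j ^ 2 ≤ 4 * N * S ∧ ‖V.starProjection (b (τ k₀))‖ ^ 2 ≤ 2 * N * S := by
  set T := (Finset.univ.erase k₀).image τ with hT
  have hTI : ∀ j ∈ T, j ∈ I ∧ τ k₀ ≠ j ∧ ∃ k, τ k = j := fun j hj => by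
    obtain ⟨k, hk, rfl⟩ := Finset.mem_image.1 hj
    exact ⟨hτ k, (hk₀ k (Finset.ne_of_mem_erase hk)).symm, k, rfl⟩
  have hcard : T.card ≤ N := by
    refine Finset.card_image_le.trans ((Finset.card_le_univ _).trans ?_)
    simp
  obtain ⟨a, h1, h2, h3⟩ := exists_starProjection_eq_sum T hb (N := N) (by exact_mod_cast hN0)
    (by exact_mod_cast hcard) hS (fun i hi j hj => hI i (hTI i hi).1 j (hTI j hj).1) (b (τ k₀))
    (fun j hj => hI _ (hτ k₀) j (hTI j hj).1 (hTI j hj).2.1) hS0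
  refine ⟨T, _, a, hcard, fun j hj => (hTI j hj).2.2, fun k hk => ?_, h1, h2, h3⟩
  exact Submodule.subset_span ⟨τ k, by
    simpa [hT] using ⟨k, hk, rfl⟩, rfl⟩

lemma two_mul_mul_le_of_le_sq (hN0 : 0 < N) (hS : S ≤ (1 / (4 * N)) ^ 2) :
    2 * N * S ≤ 1 / (8 * N) := by
  have : (0 : ℝ) < N := by exact_mod_cast hN0
  calc 2 * N * S ≤ 2 * N * (1 / (4 * N)) ^ 2 := by gcongr
    _ = _ := by field_simp; norm_num

variable [MeasurableSpace E] [BorelSpace E]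

/-- First-order decorrelation: one centered factor with a unique index. -/
lemma abs_integral_prod_le_sqrt (hN : Even N) (hN0 : 0 < N) (hb : ∀ i, ‖b i‖ = 1) (hS0 : 0 ≤ S)
    (hS : S ≤ (1 / (4 * N)) ^ 2) (hI : ∀ i ∈ I, ∀ j ∈ I, i ≠ j → inner ℝ (b i) (b j) ^ 2 ≤ S)
    (hD : ∫ x, gaussianEnvelope N x ^ N ∂(gaussianReal 0 1) ≤ D)
    (hF : ∀ k, IsGaussianFactor N D (F k)) (hτ : ∀ k, τ k ∈ I) {k₀ : Fin N}
    (hk₀ : ∀ k, k ≠ k₀ → τ k ≠ τ k₀) (h0 : ∫ x, F k₀ x ∂(gaussianReal 0 1) = 0) :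
    |∫ g, ∏ k, F k (inner ℝ (b (τ k)) g) ∂(stdGaussian E)|
      ≤ 2 * √(1 + D) * (N * D) * √(2 * N) * √S := by
  obtain ⟨T, V, a, -, -, hV, -, -, hu⟩ := exists_projection_erase hN0 hb hS0 hS hI hτ hk₀
  have hD0 : 0 ≤ D := nonneg_of_integral_gaussianEnvelope_pow_le hD
  refine (abs_integral_prod_le_of_projection (c := fun k => b (τ k)) hN hN0 hF
    (fun k => hb _) hD h0 V hV (hu.trans (two_mul_mul_le_of_le_sq hN0 hS))).trans ?_
  rw [mul_assoc _ (√_) (√_), ← Real.sqrt_mul (by positivity)]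
  gcongr
  exact Real.le_sqrt_of_sq_le hu

/-- Second-order decorrelation: three centered factors with unique indices. -/
lemma abs_integral_prod_le_mul (hN : Even N) (hN0 : 0 < N) (hb : ∀ i, ‖b i‖ = 1) (hS0 : 0 ≤ S)
    (hS : S ≤ (1 / (4 * N)) ^ 2)
    (hI : ∀ k l, τ k ≠ τ l → inner ℝ (b (τ k)) (b (τ l)) ^ 2 ≤ S)
    (hD : ∫ x, gaussianEnvelope N x ^ N ∂(gaussianReal 0 1) ≤ D)
    (hF : ∀ k, IsGaussianFactor N D (F k)) {k₁ k₂ k₃ : Fin N} (h12 : k₂ ≠ k₁) (h13 : k₃ ≠ k₁)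
    (h23 : k₂ ≠ k₃) (hk₁ : ∀ k, k ≠ k₁ → τ k ≠ τ k₁) (hk₂ : ∀ k, k ≠ k₂ → τ k ≠ τ k₂)
    (hk₃ : ∀ k, k ≠ k₃ → τ k ≠ τ k₃) (h0 : ∀ k, ∫ x, F k x ∂(gaussianReal 0 1) = 0) :
    |∫ g, ∏ k, F k (inner ℝ (b (τ k)) g) ∂(stdGaussian E)|
      ≤ √(1 + D) * (N * D) * (2 * N) * (2 * √(1 + D) * √(2 * N) + 1) * S := by
  have hI' : ∀ i ∈ Set.range τ, ∀ j ∈ Set.range τ, i ≠ j → inner ℝ (b i) (b j) ^ 2 ≤ S := by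
    rintro _ ⟨k, rfl⟩ _ ⟨l, rfl⟩; exact hI k l
  have hD0 : 0 ≤ D := nonneg_of_integral_gaussianEnvelope_pow_le hD
  obtain ⟨T, V, a, hT, hTτ, hV, hsum, ha, hu⟩ :=
    exists_projection_erase hN0 hb hS0 hS hI' (fun k => Set.mem_range_self k) hk₁
  have hmain := abs_integral_prod_sub_le (c := fun k => b (τ k)) hN hN0 hF (fun k => hb _) hD
    (h0 k₁) V hV (hu.trans (two_mul_mul_le_of_le_sq hN0 hS))
  have hid := isGaussianFactor_id hN hN0 hD
  have hF' := IsGaussianFactor.update hF hid k₁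
  set B : ℝ := 2 * √(1 + D) * (N * D) * √(2 * N) with hB
  have hB0 : 0 ≤ B := by positivity
  have hterm : ∀ j ∈ T, |∫ g, inner ℝ (b j) g * ∏ k ∈ Finset.univ.erase k₁,
      F k (inner ℝ (b (τ k)) g) ∂(stdGaussian E)| ≤ B * √S := fun j hj => by
    have key : ∀ k', k' ≠ k₁ → (∀ k, k ≠ k' → τ k ≠ τ k') → τ k' ≠ j →
        |∫ g, inner ℝ (b j) g * ∏ k ∈ Finset.univ.erase k₁,
          F k (inner ℝ (b (τ k)) g) ∂(stdGaussian E)| ≤ B * √S := fun k' hk' hτk' hj' => by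
      have h := abs_integral_prod_le_sqrt (τ := Function.update τ k₁ j) hN hN0 hb hS0 hS hI' hD
        hF' (fun k => ?_) (k₀ := k') (fun k hk => ?_) ?_
      · have e : ∀ k, b (Function.update τ k₁ j k)
            = Function.update (fun k => b (τ k)) k₁ (b j) k := fun k =>
          Function.apply_update (fun _ => b) τ k₁ j k
        simp only [e, prod_update_comp_inner] at h
        exact h
      · rcases eq_or_ne k k₁ with rfl | h
        · rw [Function.update_self]; exact hTτ j hj
        · rw [Function.update_of_ne h]; exact Set.mem_range_self k
      · rw [Function.update_of_ne hk']
        rcases eq_or_ne k k₁ with rfl | h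
        · rw [Function.update_self]; exact hj'.symm
        · rw [Function.update_of_ne h]; exact hτk' k hk
      · rw [Function.update_of_ne hk']; exact h0 k'
    by_cases h : τ k₂ = j
    · exact key k₃ h13 hk₃ fun h' => hk₃ k₂ h23 (h.trans h'.symm)
    · exact key k₂ h12 hk₂ h
  have hexp : ∫ g, inner ℝ (V.starProjection (b (τ k₁))) g *
        ∏ k ∈ Finset.univ.erase k₁, F k (inner ℝ (b (τ k)) g) ∂(stdGaussian E)
      = ∑ j ∈ T, a j * ∫ g, inner ℝ (b j) g *
        ∏ k ∈ Finset.univ.erase k₁, F k (inner ℝ (b (τ k)) g) ∂(stdGaussian E) := by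
    simp_rw [hsum, sum_inner, real_inner_smul_left, Finset.sum_mul, mul_assoc]
    rw [integral_finsetSum]
    · simp_rw [integral_const_mul]
    · exact fun j _ => (integrable_factor_mul_prod_erase (c := fun k => b (τ k)) hN hN0 hF
        (fun k => hb _) hid (hb j) k₁).const_mul (a j)
  have hasum : ∑ j ∈ T, |a j| ≤ 2 * N * √S := by
    refine abs_le_of_sq_le_sq' ?_ (by positivity) |>.2
    refine sq_sum_le_card_mul_sum_sq.trans ?_
    simp_rw [sq_abs]
    rw [mul_pow, Real.sq_sqrt hS0]
    calc (T.card : ℝ) * ∑ j ∈ T, a j ^ 2 ≤ N * (4 * N * S) := by gcongr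
      _ = _ := by ring
  have hexp' : |∫ g, inner ℝ (V.starProjection (b (τ k₁))) g *
        ∏ k ∈ Finset.univ.erase k₁, F k (inner ℝ (b (τ k)) g) ∂(stdGaussian E)|
      ≤ 2 * N * B * S := by
    rw [hexp]
    calc _ ≤ ∑ j ∈ T, |a j| * (B * √S) := by
          refine (Finset.abs_sum_le_sum_abs _ _).trans (Finset.sum_le_sum fun j hj => ?_)
          rw [abs_mul]
          exact mul_le_mul_of_nonneg_left (hterm j hj) (abs_nonneg _)
      _ ≤ 2 * N * √S * (B * √S) := by
          rw [← Finset.sum_mul]; gcongr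
      _ = 2 * N * B * (√S * √S) := by ring
      _ = _ := by rw [Real.mul_self_sqrt hS0]
  have h4 := mul_le_mul (abs_integral_mul_id_le hN hN0 (hF k₁)) hexp' (abs_nonneg _) (by positivity)
  rw [← abs_mul] at h4
  have h6 : √(1 + D) * ‖V.starProjection (b (τ k₁))‖ ^ 2 * (N * D)
      ≤ √(1 + D) * (2 * N * S) * (N * D) := by gcongr
  have h3 := abs_le.1 hmain
  have h5 := abs_le.1 h4
  have e : √(1 + D) * (N * D) * (2 * N) * (2 * √(1 + D) * √(2 * N) + 1) * S
      = √(1 + D) * (2 * N * B * S) + √(1 + D) * (2 * N * S) * (N * D) := by rw [hB]; ring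
  rw [e, abs_le]
  constructor <;> linarith [h3.1, h3.2, h5.1, h5.2]

lemma abs_integral_prod_le_card_mul (hN : Even N) (hN0 : 0 < N) (hb : ∀ i, ‖b i‖ = 1)
    (hF : ∀ k, IsGaussianFactor N D (F k)) :
    |∫ g, ∏ k, F k (inner ℝ (b (τ k)) g) ∂(stdGaussian E)| ≤ N * D :=
  abs_integral_le_integral_abs.trans (integral_abs_prod_comp_inner_le hN hN0
    (fun k => (hF k).measurable) (fun k => (hF k).integrable_pow) (fun k => hb (τ k))
    fun k => (hF k).integral_pow_le)

/-- The constant in the second-order decorrelation estimate. -/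
noncomputable def decorrelationConst (N : ℕ) (D : ℝ) : ℝ :=
  √(1 + D) * (N * D) * (2 * N) * (2 * √(1 + D) * √(2 * N) + 1) + N * D * (4 * N) ^ 2

lemma decorrelationConst_nonneg (hD : 0 ≤ D) : 0 ≤ decorrelationConst N D := by
  unfold decorrelationConst; positivity

lemma abs_integral_prod_le_decorrelationConst (hN : Even N) (hN0 : 0 < N) (hb : ∀ i, ‖b i‖ = 1)
    (hS0 : 0 ≤ S) (hI : ∀ k l, τ k ≠ τ l → inner ℝ (b (τ k)) (b (τ l)) ^ 2 ≤ S)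
    (hD : ∫ x, gaussianEnvelope N x ^ N ∂(gaussianReal 0 1) ≤ D)
    (hF : ∀ k, IsGaussianFactor N D (F k)) {k₁ k₂ k₃ : Fin N} (h12 : k₂ ≠ k₁) (h13 : k₃ ≠ k₁)
    (h23 : k₂ ≠ k₃) (hk₁ : ∀ k, k ≠ k₁ → τ k ≠ τ k₁) (hk₂ : ∀ k, k ≠ k₂ → τ k ≠ τ k₂)
    (hk₃ : ∀ k, k ≠ k₃ → τ k ≠ τ k₃) (h0 : ∀ k, ∫ x, F k x ∂(gaussianReal 0 1) = 0) :
    |∫ g, ∏ k, F k (inner ℝ (b (τ k)) g) ∂(stdGaussian E)| ≤ decorrelationConst N D * S := by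
  have hD0 : 0 ≤ D := nonneg_of_integral_gaussianEnvelope_pow_le hD
  rw [decorrelationConst, add_mul]
  rcases le_total S ((1 / (4 * N)) ^ 2) with hS | hS
  · refine (abs_integral_prod_le_mul hN hN0 hb hS0 hS hI hD hF h12 h13 h23 hk₁ hk₂ hk₃ h0).trans ?_
    have : 0 ≤ N * D * (4 * N : ℝ) ^ 2 * S := by positivity
    linarith
  · refine (abs_integral_prod_le_card_mul hN hN0 hb hF).trans ?_
    have h1 : 0 ≤ √(1 + D) * (N * D) * (2 * N) * (2 * √(1 + D) * √(2 * N) + 1) * S := by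
      positivity
    have hN' : (0 : ℝ) < N := by exact_mod_cast hN0
    have h2 : N * D ≤ N * D * (4 * N : ℝ) ^ 2 * S := by
      calc (N : ℝ) * D = N * D * (4 * N : ℝ) ^ 2 * (1 / (4 * N)) ^ 2 := by field_simp
        _ ≤ _ := by gcongr
    linarith

end

/-- The pattern of two coincidences in a tuple with few non-repeated values. -/
def HasTwoCoincidences {ι : Type*} {N : ℕ} (t : Fin N → ι) : Prop :=
  ∃ k l k' l' : Fin N, k ≠ l ∧ k' ≠ k ∧ k' ≠ l ∧ l' ≠ k' ∧ t k = t l ∧ t k' = t l'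

lemma exists_three_unique_or_hasTwoCoincidences {ι : Type*} {N : ℕ} (hN : 5 ≤ N)
    (t : Fin N → ι) :
    (∃ k₁ k₂ k₃ : Fin N, k₂ ≠ k₁ ∧ k₃ ≠ k₁ ∧ k₂ ≠ k₃ ∧ (∀ k, k ≠ k₁ → t k ≠ t k₁) ∧
      (∀ k, k ≠ k₂ → t k ≠ t k₂) ∧ ∀ k, k ≠ k₃ → t k ≠ t k₃) ∨ HasTwoCoincidences t := by
  classical
  set s : Finset (Fin N) := Finset.univ.filter fun a => ∀ k, k ≠ a → t k ≠ t a with hs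
  rcases lt_or_ge 2 s.card with h | h
  · obtain ⟨a, ha, b, hb, c, hc, hab, hac, hbc⟩ := Finset.two_lt_card.1 h
    rw [hs, Finset.mem_filter] at ha hb hc
    exact Or.inl ⟨a, b, c, hab.symm, hac.symm, hbc, ha.2, hb.2, hc.2⟩
  · right
    have hmem : ∀ a, a ∉ s → ∃ l, l ≠ a ∧ t l = t a := fun a ha => by
      simpa [hs] using ha
    have hex : ∀ u : Finset (Fin N), u.card ≤ 4 → ∃ a, a ∉ u := fun u hu => by
      by_contra! hall
      have : u = Finset.univ := Finset.eq_univ_iff_forall.2 hall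
      rw [this, Finset.card_univ, Fintype.card_fin] at hu
      omega
    obtain ⟨k, hk⟩ := hex s (by omega)
    obtain ⟨l, hl, hkl⟩ := hmem k hk
    obtain ⟨k', hk'⟩ := hex (s ∪ {k, l}) ((Finset.card_union_le _ _).trans (by
      have := Finset.card_le_two (a := k) (b := l); omega))
    simp only [Finset.mem_union, Finset.mem_insert, Finset.mem_singleton, not_or] at hk'
    obtain ⟨l', hl', hkl'⟩ := hmem k' hk'.1
    exact ⟨k, l, k', l', hl.symm, hk'.2.1, hk'.2.2, hl', hkl.symm, hkl'.symm⟩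

section
variable {ι : Type*} [Fintype ι] {N : ℕ}

lemma card_filter_le_of_determined {k k' : Fin N} (hk : k ≠ k') (p : (Fin N → ι) → Prop)
    [DecidablePred p]
    (hp : ∀ s t, p s → p t → (∀ x, x ≠ k → x ≠ k' → s x = t x) → s = t) :
    (Finset.univ.filter p).card ≤ Fintype.card ι ^ (N - 2) := by
  classical
  have h : Fintype.card {x : Fin N // x ≠ k ∧ x ≠ k'} = N - 2 := by
    rw [Fintype.card_subtype]
    have : Finset.univ.filter (fun x : Fin N => x ≠ k ∧ x ≠ k') = ({k, k'} : Finset (Fin N))ᶜ := by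
      ext x; simp
    rw [this, Finset.card_compl, Finset.card_pair hk, Fintype.card_fin]
  have h2 : Fintype.card ({x : Fin N // x ≠ k ∧ x ≠ k'} → ι) = Fintype.card ι ^ (N - 2) := by
    rw [Fintype.card_fun, h]
  rw [← h2, ← Finset.card_univ]
  refine Finset.card_le_card_of_injOn (fun t x => t x) (fun _ _ => Finset.mem_univ _) ?_
  intro s hs t ht hst
  refine hp s t (by simpa using hs) (by simpa using ht) fun x h1 h2 => ?_
  exact congr_fun hst ⟨x, h1, h2⟩

lemma sum_apply_pair_le {k l : Fin N} (hkl : k ≠ l) {w : ι → ι → ℝ} (hw : ∀ i j, 0 ≤ w i j) :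
    ∑ t : Fin N → ι, w (t k) (t l) ≤ (Fintype.card ι : ℝ) ^ (N - 2) * ∑ i, ∑ j, w i j := by
  classical
  have h : ∑ t : Fin N → ι, w (t k) (t l)
      = ∑ q : ι × ι, ∑ t ∈ Finset.univ.filter (fun t : Fin N → ι => (t k, t l) = q), w q.1 q.2 := by
    rw [← Finset.sum_fiberwise (s := Finset.univ) (g := fun t : Fin N → ι => (t k, t l))]
    refine Finset.sum_congr rfl fun q _ => Finset.sum_congr rfl fun t ht => ?_
    rw [← (Finset.mem_filter.1 ht).2]
  rw [h, ← Fintype.sum_prod_type', Finset.mul_sum]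
  refine Finset.sum_le_sum fun q _ => ?_
  rw [Finset.sum_const, nsmul_eq_mul]
  refine mul_le_mul_of_nonneg_right ?_ (hw _ _)
  exact_mod_cast card_filter_le_of_determined hkl _ fun s t hs ht hst => by
    funext x
    have e := hs.trans ht.symm
    rw [Prod.mk.injEq] at e
    by_cases h1 : x = k
    · rw [h1, e.1]
    by_cases h2 : x = l
    · rw [h2, e.2]
    exact hst x h1 h2

open Classical in
lemma card_hasTwoCoincidences_le :
    (Finset.univ.filter fun t : Fin N → ι => HasTwoCoincidences t).card
      ≤ N ^ 4 * Fintype.card ι ^ (N - 2) := by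
  have hsub : (Finset.univ.filter fun t : Fin N → ι => HasTwoCoincidences t) ⊆
      (Finset.univ : Finset (Fin N × Fin N × Fin N × Fin N)).biUnion fun q =>
        Finset.univ.filter fun t : Fin N → ι => q.1 ≠ q.2.1 ∧ q.2.2.1 ≠ q.1 ∧ q.2.2.1 ≠ q.2.1 ∧
          q.2.2.2 ≠ q.2.2.1 ∧ t q.1 = t q.2.1 ∧ t q.2.2.1 = t q.2.2.2 := fun t ht => by
    obtain ⟨k, l, k', l', h⟩ := (Finset.mem_filter.1 ht).2
    exact Finset.mem_biUnion.2 ⟨(k, l, k', l'), Finset.mem_univ _,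
      Finset.mem_filter.2 ⟨Finset.mem_univ _, h⟩⟩
  refine (Finset.card_le_card hsub).trans ((Finset.card_biUnion_le_card_mul _ _
    (Fintype.card ι ^ (N - 2)) ?_).trans (le_of_eq ?_))
  · rintro ⟨k, l, k', l'⟩ -
    by_cases hkk : k = k'
    · rw [Finset.filter_false_of_mem fun t _ h => h.2.1 hkk.symm]
      exact Nat.zero_le _
    refine card_filter_le_of_determined hkk _ fun s t hs ht hst => ?_
    obtain ⟨h1, h2, h3, h4, h5, h6⟩ := hs
    obtain ⟨-, -, -, -, h5', h6'⟩ := ht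
    have e1 : s k = t k := by
      rw [h5, h5']; exact hst l h1.symm h3.symm
    have e2 : s k' = t k' := by
      rw [h6, h6']
      by_cases hl : l' = k
      · rw [hl, e1]
      · exact hst l' hl h4
    funext x
    by_cases hx1 : x = k
    · rw [hx1, e1]
    by_cases hx2 : x = k'
    · rw [hx2, e2]
    exact hst x hx1 hx2
  · simp only [Finset.card_univ, Fintype.card_prod, Fintype.card_fin]
    ring

variable {E : Type*} [NormedAddCommGroup E] [InnerProductSpace ℝ E]
  [FiniteDimensional ℝ E] [MeasurableSpace E] [BorelSpace E] {D R : ℝ} {b : ι → E}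
  {f : ι → ℝ → ℝ}

open Classical in
/-- Moment bound for a sum of centered functions of weakly correlated standard Gaussians. -/
theorem integral_sum_comp_inner_pow_le (hN : Even N) (hN5 : 5 ≤ N) (hb : ∀ i, ‖b i‖ = 1)
    (hR : ∑ i, ∑ j, (if i = j then 0 else inner ℝ (b i) (b j) ^ 2) ≤ R)
    (hD : ∫ x, gaussianEnvelope N x ^ N ∂(gaussianReal 0 1) ≤ D)
    (hf : ∀ i, IsGaussianFactor N D (f i)) (h0 : ∀ i, ∫ x, f i x ∂(gaussianReal 0 1) = 0) :
    ∫ g, (∑ i, f i (inner ℝ (b i) g)) ^ N ∂(stdGaussian E)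
      ≤ (decorrelationConst N D * (N ^ 2 * R) + N * D * N ^ 4) *
        (Fintype.card ι : ℝ) ^ (N - 2) := by
  have hN0 : 0 < N := by omega
  have hD0 : 0 ≤ D := nonneg_of_integral_gaussianEnvelope_pow_le hD
  set w : ι → ι → ℝ := fun i j => if i = j then 0 else inner ℝ (b i) (b j) ^ 2 with hw
  have hw0 : ∀ i j, 0 ≤ w i j := fun i j => by
    simp only [hw]; split_ifs <;> positivity
  have hterm : ∀ t : Fin N → ι,
      ∫ g, ∏ k, f (t k) (inner ℝ (b (t k)) g) ∂(stdGaussian E)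
        ≤ decorrelationConst N D * ∑ k, ∑ l, w (t k) (t l)
          + N * D * (if HasTwoCoincidences t then 1 else 0) := fun t => by
    have hS : ∀ k l, w (t k) (t l) ≤ ∑ k, ∑ l, w (t k) (t l) := fun k l =>
      (Finset.single_le_sum (f := fun l => w (t k) (t l)) (fun _ _ => hw0 _ _)
        (Finset.mem_univ l)).trans
      (Finset.single_le_sum (f := fun k => ∑ l, w (t k) (t l))
        (fun _ _ => Finset.sum_nonneg fun _ _ => hw0 _ _) (Finset.mem_univ k))
    have hS0 : 0 ≤ ∑ k, ∑ l, w (t k) (t l) :=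
      Finset.sum_nonneg fun _ _ => Finset.sum_nonneg fun _ _ => hw0 _ _
    refine (le_abs_self _).trans ?_
    rcases exists_three_unique_or_hasTwoCoincidences hN5 t with
      ⟨k₁, k₂, k₃, h12, h13, h23, hk₁, hk₂, hk₃⟩ | h
    · refine (abs_integral_prod_le_decorrelationConst (F := fun k => f (t k)) hN hN0 hb hS0
        (fun k l hkl => ?_) hD (fun k => hf _) h12 h13 h23 hk₁ hk₂ hk₃ fun k => h0 _).trans ?_
      · refine le_trans (le_of_eq ?_) (hS k l)
        simp only [hw]; rw [if_neg hkl]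
      · refine le_add_of_nonneg_right ?_
        split_ifs <;> positivity
    · refine (abs_integral_prod_le_card_mul (F := fun k => f (t k)) hN hN0 hb
        fun k => hf _).trans ?_
      rw [if_pos h, mul_one]
      exact le_add_of_nonneg_left (mul_nonneg (decorrelationConst_nonneg hD0) hS0)
  have hsum1 : ∑ t : Fin N → ι, ∑ k, ∑ l, w (t k) (t l)
      ≤ N ^ 2 * R * (Fintype.card ι : ℝ) ^ (N - 2) := by
    rw [Finset.sum_comm]
    simp_rw [fun k : Fin N => Finset.sum_comm (s := (Finset.univ : Finset (Fin N → ι)))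
      (t := Finset.univ) (f := fun t l => w (t k) (t l))]
    have hkl : ∀ k l : Fin N, ∑ t : Fin N → ι, w (t k) (t l)
        ≤ (Fintype.card ι : ℝ) ^ (N - 2) * R := fun k l => by
      rcases eq_or_ne k l with rfl | h
      · have : 0 ≤ R := le_trans
          (Finset.sum_nonneg fun i _ => Finset.sum_nonneg fun j _ => hw0 i j) hR
        simp only [hw, if_true, Finset.sum_const_zero]
        positivity
      · exact (sum_apply_pair_le h hw0).trans (by gcongr)
    calc _ ≤ ∑ _k : Fin N, ∑ _l : Fin N, (Fintype.card ι : ℝ) ^ (N - 2) * R :=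
          Finset.sum_le_sum fun k _ => Finset.sum_le_sum fun l _ => hkl k l
      _ = _ := by simp; ring
  have hsum2 : ∑ t : Fin N → ι, (if HasTwoCoincidences t then (1 : ℝ) else 0)
      ≤ N ^ 4 * (Fintype.card ι : ℝ) ^ (N - 2) := by
    rw [Finset.sum_boole]
    exact_mod_cast card_hasTwoCoincidences_le
  simp_rw [Fintype.sum_pow]
  rw [integral_finsetSum]
  · refine (Finset.sum_le_sum fun t _ => hterm t).trans ?_
    rw [Finset.sum_add_distrib, ← Finset.mul_sum, ← Finset.mul_sum]
    calc _ ≤ decorrelationConst N D * (N ^ 2 * R * (Fintype.card ι : ℝ) ^ (N - 2))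
          + N * D * (N ^ 4 * (Fintype.card ι : ℝ) ^ (N - 2)) := by
          have := decorrelationConst_nonneg (N := N) hD0
          gcongr
      _ = _ := by ring
  · exact fun t _ => integrable_prod_comp_inner (F := fun k => f (t k)) hN hN0
      (fun k => (hf _).measurable) (fun k => (hf _).integrable_pow) fun k => hb _

end

section
variable {ι : Type*} [Fintype ι] {N : ℕ} {E : Type*} [NormedAddCommGroup E] [InnerProductSpace ℝ E]
  [FiniteDimensional ℝ E] [MeasurableSpace E] [BorelSpace E] {R M : ℝ} {b : ι → E}
  {h : ι → ℝ → ℝ}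

/-- The constant in the moment bound for sums, depending on the moment and the correlations. -/
noncomputable def momentConst (N : ℕ) (R : ℝ) : ℝ :=
  decorrelationConst N (max 1 (∫ x, gaussianEnvelope N x ^ N ∂(gaussianReal 0 1))) * (N ^ 2 * R)
    + N * max 1 (∫ x, gaussianEnvelope N x ^ N ∂(gaussianReal 0 1)) * N ^ 4

lemma momentConst_nonneg (hR : 0 ≤ R) : 0 ≤ momentConst N R := by
  unfold momentConst
  have h1 : 0 ≤ max 1 (∫ x, gaussianEnvelope N x ^ N ∂(gaussianReal 0 1)) :=
    zero_le_one.trans (le_max_left _ _)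
  have := decorrelationConst_nonneg (N := N) h1
  positivity

open Classical in
lemma integral_sum_comp_inner_pow_le_mul (hN : Even N) (hN5 : 5 ≤ N) (hb : ∀ i, ‖b i‖ = 1)
    (hR : ∑ i, ∑ j, (if i = j then 0 else inner ℝ (b i) (b j) ^ 2) ≤ R)
    (hm : ∀ i, Measurable (h i))
    (hi : ∀ i, Integrable (fun x => h i x ^ N) (gaussianReal 0 1))
    (h0 : ∀ i, ∫ x, h i x ∂(gaussianReal 0 1) = 0) (hM0 : 0 ≤ M)
    (hM : ∀ i, ∫ x, h i x ^ N ∂(gaussianReal 0 1) ≤ M) :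
    ∫ g, (∑ i, h i (inner ℝ (b i) g)) ^ N ∂(stdGaussian E)
      ≤ momentConst N R * (Fintype.card ι : ℝ) ^ (N - 2) * M := by
  have hR0 : 0 ≤ R := le_trans (Finset.sum_nonneg fun i _ => Finset.sum_nonneg fun j _ => by
    split_ifs <;> positivity) hR
  set A := momentConst N R * (Fintype.card ι : ℝ) ^ (N - 2) with hA
  have hpos : ∀ M' : ℝ, M < M' →
      ∫ g, (∑ i, h i (inner ℝ (b i) g)) ^ N ∂(stdGaussian E) ≤ A * M' := fun M' hMM' => by
    have hM' : 0 < M' := hM0.trans_lt hMM'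
    set c : ℝ := (M'⁻¹) ^ ((N : ℝ)⁻¹) with hc
    have hcN : c ^ N = M'⁻¹ := Real.rpow_inv_natCast_pow (inv_nonneg.2 hM'.le) (by omega)
    have hmain := integral_sum_comp_inner_pow_le (f := fun i x => c * h i x) hN hN5 hb hR
      (le_max_right 1 _) (fun i => ⟨(hm i).const_mul c, ?_, ?_⟩) fun i => ?_
    · simp_rw [← Finset.mul_sum, mul_pow, hcN] at hmain
      rw [integral_const_mul, inv_mul_le_iff₀ hM', mul_comm] at hmain
      exact hmain
    · simp_rw [mul_pow]
      exact (hi i).const_mul _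
    · simp_rw [mul_pow]
      rw [integral_const_mul, hcN]
      refine le_trans ?_ (le_max_left _ _)
      rw [inv_mul_le_iff₀ hM', mul_one]
      exact (hM i).trans hMM'.le
    · rw [integral_const_mul, h0, mul_zero]
  have hA0 : 0 ≤ A := mul_nonneg (momentConst_nonneg hR0) (by positivity)
  refine ge_of_tendsto (x := nhdsWithin M (Set.Ioi M)) (f := fun M' => A * M') ?_ ?_
  · exact ((continuous_const.mul continuous_id).tendsto M).mono_left nhdsWithin_le_nhds
  · exact eventually_nhdsWithin_of_forall hpos

end

lemma gaussianReal_toNNReal_eq_map {v : ℝ} (hv : 0 ≤ v) :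
    gaussianReal 0 (Real.toNNReal v) = (gaussianReal 0 1).map (fun x => √v * x) := by
  rw [gaussianReal_map_const_mul, mul_zero]
  congr 1
  ext
  simp [Real.sq_sqrt hv, hv]

lemma sum_ite_eq_le_two_mul {n : ℕ} {x : Fin n → Fin n → ℝ} (hx : ∀ i j, x i j = x j i) {R : ℝ}
    (hR : ∑ q ∈ Finset.univ.filter (fun q : Fin n × Fin n => q.1 < q.2), x q.1 q.2 ≤ R) :
    ∑ i, ∑ j, (if i = j then 0 else x i j) ≤ 2 * R := by
  have e : ∀ i j, (if i = j then 0 else x i j)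
      = (if i < j then x i j else 0) + (if j < i then x j i else 0) := fun i j => by
    rcases lt_trichotomy i j with h | h | h
    · simp [h, h.ne, h.not_gt]
    · simp [h]
    · simp [h, h.ne', h.not_gt, hx i j]
  have h1 : ∑ i, ∑ j, (if i < j then x i j else 0) ≤ R := by
    rw [← Fintype.sum_prod_type' (f := fun i j => if i < j then x i j else 0), ← Finset.sum_filter]
    exact hR
  simp_rw [e, Finset.sum_add_distrib]
  rw [Finset.sum_comm (f := fun i j => if j < i then x j i else 0)]
  linarith

lemma integral_comp_mulVec {n m : ℕ} (B : Matrix (Fin n) (Fin m) ℝ) {H : (Fin n → ℝ) → ℝ}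
    (hH : Measurable H) :
    ∫ y, H y ∂(Measure.map B.mulVec (Measure.pi fun _ : Fin m => gaussianReal 0 1))
      = ∫ g, H (fun i => inner ℝ (WithLp.toLp 2 (B i)) g)
        ∂(stdGaussian (EuclideanSpace ℝ (Fin m))) := by
  have hB : Measurable B.mulVec := (by fun_prop : Continuous B.mulVec).measurable
  rw [integral_map hB.aemeasurable hH.aestronglyMeasurable, ← map_pi_eq_stdGaussian, integral_map]
  · refine integral_congr_ae (ae_of_all _ fun x => ?_)
    simp only
    congr 1
    funext i
    rw [EuclideanSpace.inner_toLp_toLp]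
    simp [Matrix.mulVec, dotProduct_comm]
  · exact (WithLp.measurable_toLp 2 _).aemeasurable
  · exact (hH.comp (measurable_pi_lambda _ fun i => by fun_prop)).aestronglyMeasurable

lemma inner_row {n m : ℕ} (B : Matrix (Fin n) (Fin m) ℝ) (i j : Fin n) :
    inner ℝ (WithLp.toLp 2 (B i) : EuclideanSpace ℝ (Fin m)) (WithLp.toLp 2 (B j))
      = (B * Bᵀ) i j := by
  rw [EuclideanSpace.inner_toLp_toLp]
  simp [Matrix.mul_apply, dotProduct, mul_comm]

end

/-- **LLN for images of weakly correlated Gaussians (max form).** Fix an integer `p ≥ 6` and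
`R ≥ 0`.  There is a constant `𝒞`, depending only on `p` and `R`, such that: for every
`z ~ N(0, K)` with `K` positive semidefinite, positive diagonal, and correlation matrix `C`
satisfying `∑_{i<j} C_{ij}² ≤ R`, and all functions `φ i` with means `μs i` and finite
`2p`-th centered moments under `N(0, K_{ii})`, the average `Q = (1/n) ∑ i, φ i (z i)`
satisfies `E[(Q − E Q)^{2p}] ≤ 𝒞 n^{-1.5} max_i E_{x ~ N(0,K_{ii})}[(φ i x − μs i)^{2p}]`. -/
theorem weakly_correlated_gaussian_lln_max
    (p : ℕ) (hp : 6 ≤ p) (R : ℝ) :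
    ∃ 𝒞 : ℝ, ∀ {Ω : Type} [MeasureSpace Ω] [IsProbabilityMeasure (volume : Measure Ω)],
      ∀ (n : ℕ) (hn : 0 < n) (K : Matrix (Fin n) (Fin n) ℝ),
      K.PosSemidef → (∀ i, 0 < K i i) →
      (∑ q ∈ Finset.univ.filter (fun q : Fin n × Fin n => q.1 < q.2),
          (K q.1 q.2 / (Real.sqrt (K q.1 q.1) * Real.sqrt (K q.2 q.2))) ^ 2 ≤ R) →
      ∀ (z : Ω → Fin n → ℝ), Measurable z →
      ∀ (m : ℕ) (B : Matrix (Fin n) (Fin m) ℝ), K = B * Bᵀ →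
      Measure.map z volume
        = Measure.map B.mulVec (Measure.pi fun _ : Fin m => gaussianReal 0 1) →
      ∀ (φ : Fin n → ℝ → ℝ), (∀ i, Measurable (φ i)) →
      ∀ (μs : Fin n → ℝ),
      (∀ i, μs i = ∫ x, φ i x ∂(gaussianReal 0 (Real.toNNReal (K i i)))) →
      (∀ i, Integrable (φ i) (gaussianReal 0 (Real.toNNReal (K i i)))) →
      (∀ i, Integrable (fun x => (φ i x - μs i) ^ (2 * p))
          (gaussianReal 0 (Real.toNNReal (K i i)))) →
      ∫ ω, ((1 / n : ℝ) * ∑ i, φ i (z ω i)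
            - ∫ ω', (1 / n : ℝ) * ∑ i, φ i (z ω' i)) ^ (2 * p)
        ≤ 𝒞 * (n : ℝ) ^ (-(1.5 : ℝ))
            * Finset.univ.sup' (Finset.univ_nonempty_iff.mpr (Fin.pos_iff_nonempty.mp hn))
                (fun i => ∫ x, (φ i x - μs i) ^ (2 * p)
                  ∂(gaussianReal 0 (Real.toNNReal (K i i)))) := by
  refine ⟨momentConst (2 * p) (2 * R), ?_⟩
  intro Ω _ _ n hn K _ hKpos hR z hz m B hK hlaw φ hφ μs hμ hφi hφp
  set M := Finset.univ.sup' (Finset.univ_nonempty_iff.mpr (Fin.pos_iff_nonempty.mp hn))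
    (fun i => ∫ x, (φ i x - μs i) ^ (2 * p) ∂(gaussianReal 0 (Real.toNNReal (K i i)))) with hMdef
  have hR0 : 0 ≤ R := (Finset.sum_nonneg fun q _ => sq_nonneg _).trans hR
  have hEven : Even (2 * p) := even_two_mul p
  set σ : Fin n → ℝ := fun i => √(K i i) with hσ
  have hσ0 : ∀ i, 0 < σ i := fun i => Real.sqrt_pos.2 (hKpos i)
  set b : Fin n → EuclideanSpace ℝ (Fin m) := fun i => (σ i)⁻¹ • WithLp.toLp 2 (B i) with hbdef
  have hinner : ∀ i j, inner ℝ (b i) (b j) = K i j / (√(K i i) * √(K j j)) := fun i j => by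
    simp only [hbdef, real_inner_smul_left, real_inner_smul_right, inner_row, ← hK, hσ]
    field_simp
  have hb : ∀ i, ‖b i‖ = 1 := fun i => by
    have h1 : ‖b i‖ ^ 2 = 1 := by
      rw [← real_inner_self_eq_norm_sq, hinner, Real.mul_self_sqrt (hKpos i).le,
        div_self (hKpos i).ne']
    exact (pow_eq_one_iff_of_nonneg (norm_nonneg _) two_ne_zero).1 h1
  have hrow : ∀ i g, inner ℝ (WithLp.toLp 2 (B i)) g = σ i * inner ℝ (b i) g := fun i g => by
    simp only [hbdef, real_inner_smul_left]
    rw [mul_inv_cancel_left₀ (hσ0 i).ne']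
  have htransfer : ∀ H : (Fin n → ℝ) → ℝ, Measurable H →
      ∫ ω, H (z ω) = ∫ g, H (fun i => σ i * inner ℝ (b i) g)
        ∂(stdGaussian (EuclideanSpace ℝ (Fin m))) := fun H hH => by
    rw [← integral_map hz.aemeasurable hH.aestronglyMeasurable, hlaw, integral_comp_mulVec B hH]
    simp_rw [hrow]
  have hscale : ∀ i {f : ℝ → ℝ}, Measurable f →
      ∫ x, f x ∂(gaussianReal 0 (Real.toNNReal (K i i)))
        = ∫ x, f (σ i * x) ∂(gaussianReal 0 1) := fun i f hf => by
    rw [gaussianReal_toNNReal_eq_map (hKpos i).le,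
      integral_map (by fun_prop) hf.aestronglyMeasurable]
  have hscale_int : ∀ i {f : ℝ → ℝ}, Integrable f (gaussianReal 0 (Real.toNNReal (K i i))) →
      Integrable (fun x => f (σ i * x)) (gaussianReal 0 1) := fun i f hf => by
    rw [gaussianReal_toNNReal_eq_map (hKpos i).le] at hf
    exact (integrable_map_measure hf.aestronglyMeasurable (by fun_prop)).1 hf
  have hmean : ∫ ω, (1 / n : ℝ) * ∑ i, φ i (z ω i) = (1 / n : ℝ) * ∑ i, μs i := by
    rw [htransfer (fun y => (1 / n : ℝ) * ∑ i, φ i (y i)) (by fun_prop), integral_const_mul,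
      integral_finsetSum _ fun i _ => integrable_comp_inner (hb i) (hscale_int i (hφi i))]
    congr 1
    refine Finset.sum_congr rfl fun i _ => ?_
    rw [integral_comp_inner (f := fun x => φ i (σ i * x)) (hb i) (by fun_prop), hμ,
      hscale i (hφ i)]
  set h : Fin n → ℝ → ℝ := fun i x => φ i (σ i * x) - μs i with hh
  have hM : ∀ i, ∫ x, h i x ^ (2 * p) ∂(gaussianReal 0 1) ≤ M := fun i => by
    rw [hMdef]
    refine le_trans (le_of_eq ?_) (Finset.le_sup' _ (Finset.mem_univ i))
    exact (hscale i (f := fun x => (φ i x - μs i) ^ (2 * p)) (by fun_prop)).symm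
  have hM0 : 0 ≤ M :=
    (integral_nonneg fun x => hEven.pow_nonneg _).trans (hM ⟨0, hn⟩)
  have hmain := integral_sum_comp_inner_pow_le_mul (b := b) (h := h) (R := 2 * R) (M := M) hEven
    (by omega) hb ?_ (fun i => by fun_prop)
    (fun i => hscale_int i (hφp i)) (fun i => ?_) hM0 hM
  · have hn1 : (1 : ℝ) ≤ n := by exact_mod_cast hn
    have hn0 : (0 : ℝ) < n := by exact_mod_cast hn
    rw [hmean, htransfer (fun y => ((1 / n : ℝ) * ∑ i, φ i (y i) - (1 / n : ℝ) * ∑ i, μs i)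
      ^ (2 * p)) (by fun_prop)]
    have e : ∀ g : EuclideanSpace ℝ (Fin m), ((1 / n : ℝ) * ∑ i, φ i (σ i * inner ℝ (b i) g)
        - (1 / n : ℝ) * ∑ i, μs i) ^ (2 * p)
        = (1 / n : ℝ) ^ (2 * p) * (∑ i, h i (inner ℝ (b i) g)) ^ (2 * p) := fun g => by
      simp only [hh]
      rw [← mul_sub, ← Finset.sum_sub_distrib, mul_pow]
    simp_rw [e]
    rw [integral_const_mul]
    rw [Fintype.card_fin] at hmain
    have hpow : (1 / n : ℝ) ^ (2 * p) * (n : ℝ) ^ (2 * p - 2) ≤ (n : ℝ) ^ (-(1.5 : ℝ)) := by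
      have h2 : (n : ℝ) ^ (2 * p) = (n : ℝ) ^ (2 * p - 2) * (n : ℝ) ^ 2 := by
        rw [← pow_add]; congr 1; omega
      have h3 : (1 / n : ℝ) ^ (2 * p) * (n : ℝ) ^ (2 * p - 2) = (n : ℝ) ^ (-(2 : ℝ)) := by
        rw [Real.rpow_neg hn0.le, one_div, inv_pow, h2, Real.rpow_ofNat]
        field_simp
      rw [h3]
      exact Real.rpow_le_rpow_of_exponent_le hn1 (by norm_num)
    have hC := momentConst_nonneg (N := 2 * p) (R := 2 * R) (by positivity)
    calc (1 / n : ℝ) ^ (2 * p) * ∫ g, (∑ i, h i (inner ℝ (b i) g)) ^ (2 * p)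
          ∂(stdGaussian (EuclideanSpace ℝ (Fin m)))
        ≤ (1 / n : ℝ) ^ (2 * p) * (momentConst (2 * p) (2 * R) * (n : ℝ) ^ (2 * p - 2) * M) := by
          gcongr
      _ = momentConst (2 * p) (2 * R) * ((1 / n : ℝ) ^ (2 * p) * (n : ℝ) ^ (2 * p - 2)) * M := by
          ring
      _ ≤ _ := by gcongr
  · simp_rw [hinner]
    refine le_trans (le_of_eq ?_) (sum_ite_eq_le_two_mul
      (x := fun i j => (K i j / (√(K i i) * √(K j j))) ^ 2) (fun i j => ?_) hR)
    · exact Finset.sum_congr rfl fun i _ => Finset.sum_congr rfl fun j _ => by congr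
    · rw [hK, ← inner_row B i j, ← inner_row B j i, real_inner_comm, mul_comm √_]
  · simp only [hh]
    rw [integral_sub (hscale_int i (hφi i)) (integrable_const _), ← hscale i (hφ i), ← hμ]
    simp
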